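/- If A ≤_LR B, then A ≤_LK B. That is, if every element of Cantor space that is Martin-Löf random relative to B is also Martin-Löf random relative to A, then there is a constant c such that K^B(τ) ≤ K^A(τ) + c for all finite binary strings τ. -/

import Mathlib

open MeasureTheory Filter

namespace LMD

/-- Codes for partial functions recursive in an oracle. -/
inductive OracleCode : Type
  | zero : OracleCode
  | succ : OracleCode
  | left : OracleCode
  | right : OracleCode
  | oracle : OracleCode
  | pair : OracleCode → OracleCode → OracleCode
  | comp : OracleCode → OracleCode → OracleCode
  | prec : OracleCode → OracleCode → OracleCode
  | rfind' : OracleCode → OracleCode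

namespace OracleCode

/-- Evaluation of an oracle code relative to a (total) oracle `O : ℕ → ℕ`. -/
def eval (O : ℕ → ℕ) : OracleCode → ℕ →. ℕ
  | zero => pure 0
  | succ => Nat.succ
  | left => ↑fun n : ℕ => n.unpair.1
  | right => ↑fun n : ℕ => n.unpair.2
  | oracle => ↑fun n : ℕ => O n
  | pair cf cg => fun n => Nat.pair <$> eval O cf n <*> eval O cg n
  | comp cf cg => fun n => eval O cg n >>= eval O cf
  | prec cf cg =>
    Nat.unpaired fun a n =>
      n.rec (eval O cf a) fun y IH => do
        let i ← IH
        eval O cg (Nat.pair a (Nat.pair y i))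
  | rfind' cf =>
    Nat.unpaired fun a m =>
      (Nat.rfind fun n => (fun m => m = 0) <$> eval O cf (Nat.pair a (n + m))).map (· + m)

/-- A Gödel numbering of oracle codes. -/
def encodeCode : OracleCode → ℕ
  | zero => 0
  | succ => 1
  | left => 2
  | right => 3
  | oracle => 4
  | pair cf cg => 4 * Nat.pair (encodeCode cf) (encodeCode cg) + 5
  | comp cf cg => 4 * Nat.pair (encodeCode cf) (encodeCode cg) + 6
  | prec cf cg => 4 * Nat.pair (encodeCode cf) (encodeCode cg) + 7
  | rfind' cf => 4 * encodeCode cf + 8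

end OracleCode

/-- `f` is partial recursive in the oracle `O`. -/
def RecursiveIn (O : ℕ → ℕ) (f : ℕ →. ℕ) : Prop := ∃ c : OracleCode, c.eval O = f

/-- The characteristic function of a set of naturals. -/
noncomputable def chi (A : Set ℕ) : ℕ → ℕ := A.indicator fun _ => 1

/-- Turing reducibility between sets of naturals. -/
def TuringLE (A B : Set ℕ) : Prop := RecursiveIn (chi B) (chi A)

/-- The Turing jump of a set of naturals. -/
def jump (B : Set ℕ) : Set ℕ :=
  {e | ∃ c : OracleCode, c.encodeCode = e ∧ (c.eval (chi B) e).Dom}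

/-- The open subset of Cantor space generated by a set of finite binary strings. -/
def Cyl (W : Set (List Bool)) : Set (ℕ → Bool) :=
  {X | ∃ σ ∈ W, ∀ i : Fin σ.length, X i = σ.get i}

/-- The fair-coin product measure on Cantor space, realized as the pushforward of
Lebesgue measure on `[0,1)` under the binary expansion map. -/
noncomputable def mu : Measure (ℕ → Bool) :=
  Measure.map (fun x n => decide (⌊x * 2 ^ (n + 1)⌋₊ % 2 = 1))
    (volume.restrict (Set.Ico (0 : ℝ) 1))

/-- `W` is a c.e.-in-`A` set of binary strings. -/
def CeIn (A : Set ℕ) (W : Set (List Bool)) : Prop :=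
  ∃ c : OracleCode, ∀ σ : List Bool, σ ∈ W ↔ (c.eval (chi A) (Encodable.encode σ)).Dom

/-- `W` is a uniformly c.e.-in-`A` sequence of sets of binary strings. -/
def CeSeqIn (A : Set ℕ) (W : ℕ → Set (List Bool)) : Prop :=
  ∃ c : OracleCode, ∀ (n : ℕ) (σ : List Bool),
    σ ∈ W n ↔ (c.eval (chi A) (Nat.pair n (Encodable.encode σ))).Dom

/-- A Martin-Löf test relative to `A`. -/
def MLTest (A : Set ℕ) (U : ℕ → Set (ℕ → Bool)) : Prop :=
  ∃ W : ℕ → Set (List Bool), CeSeqIn A W ∧ (∀ n, U n = Cyl (W n)) ∧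
    (∀ n, U (n + 1) ⊆ U n) ∧ ∀ n, mu (U n) ≤ 2⁻¹ ^ n

/-- `X` is Martin-Löf random relative to `A`. -/
def MLRandom (A : Set ℕ) (X : ℕ → Bool) : Prop :=
  ∀ U : ℕ → Set (ℕ → Bool), MLTest A U → X ∉ ⋂ n, U n

/-- `A ≤_LR B`: every `B`-random is `A`-random. -/
def LRle (A B : Set ℕ) : Prop := ∀ X : ℕ → Bool, MLRandom B X → MLRandom A X

/-- Evaluation of an oracle machine on binary strings. -/
def evalStr (c : OracleCode) (O : ℕ → ℕ) (σ : List Bool) : Part (List Bool) :=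
  (c.eval O (Encodable.encode σ)).bind fun m => Part.ofOption (Encodable.decode m)

/-- `c` is a prefix-free oracle machine: for every oracle its domain is prefix-free. -/
def PrefixFreeMachine (c : OracleCode) : Prop :=
  ∀ (O : ℕ → ℕ) (σ₁ σ₂ : List Bool), σ₁ <+: σ₂ →
    (evalStr c O σ₁).Dom → (evalStr c O σ₂).Dom → σ₁ = σ₂

/-- `u` is a universal prefix-free oracle machine. -/
def UniversalPFM (u : OracleCode) : Prop :=
  PrefixFreeMachine u ∧
    ∀ c : OracleCode, PrefixFreeMachine c → ∃ d : ℕ, ∀ (O : ℕ → ℕ) (σ τ : List Bool),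
      τ ∈ evalStr c O σ → ∃ σ' : List Bool, τ ∈ evalStr u O σ' ∧ σ'.length ≤ σ.length + d

/-- Prefix-free Kolmogorov complexity relative to the oracle `O`,
measured by the universal machine `u` (`⊤` if `τ` is not in the range). -/
noncomputable def K (u : OracleCode) (O : ℕ → ℕ) (τ : List Bool) : ℕ∞ :=
  ⨅ σ ∈ {σ : List Bool | τ ∈ evalStr u O σ}, (σ.length : ℕ∞)

/-- `A ≤_LK B` with respect to the universal machine `u`. -/
def LKle (u : OracleCode) (A B : Set ℕ) : Prop :=
  ∃ d : ℕ, ∀ τ : List Bool, K u (chi B) τ ≤ K u (chi A) τ + (d : ℕ∞)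

/-- The initial segment of length `s` of a sequence. -/
def seg {α : Type*} (f : ℕ → α) (s : ℕ) : List α := (List.range s).map f

@[simp] theorem seg_zero {α : Type*} (f : ℕ → α) : seg f 0 = [] := rfl

theorem seg_succ {α : Type*} (f : ℕ → α) (s : ℕ) : seg f (s + 1) = seg f s ++ [f s] := by
  simp [seg, List.range_succ]

@[simp] theorem length_seg {α : Type*} (f : ℕ → α) (s : ℕ) : (seg f s).length = s := by
  simp [seg]

theorem take_seg {α : Type*} (f : ℕ → α) (s t : ℕ) : (seg f t).take s = seg f (min s t) := by
  simp [seg, ← List.map_take, List.take_range]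

theorem take_seg_of_le {α : Type*} (f : ℕ → α) {s t : ℕ} (h : s ≤ t) :
    (seg f t).take s = seg f s := by
  rw [take_seg, min_eq_left h]

theorem getElem?_seg {α : Type*} (f : ℕ → α) (s i : ℕ) :
    (seg f s)[i]? = if i < s then some (f i) else none := by
  by_cases h : i < s <;> simp [seg, h]

namespace OracleCode

/-- Every ordinary code is an oracle code that does not query the oracle. -/
def ofCode : Nat.Partrec.Code → OracleCode
  | .zero => zero
  | .succ => succ
  | .left => left
  | .right => right
  | .pair cf cg => pair (ofCode cf) (ofCode cg)
  | .comp cf cg => comp (ofCode cf) (ofCode cg)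
  | .prec cf cg => prec (ofCode cf) (ofCode cg)
  | .rfind' cf => rfind' (ofCode cf)

theorem eval_ofCode (O : ℕ → ℕ) (c : Nat.Partrec.Code) : (ofCode c).eval O = c.eval := by
  induction c with
  | zero => rfl
  | succ => rfl
  | left => rfl
  | right => rfl
  | pair cf cg hf hg => rw [ofCode, eval, hf, hg]; rfl
  | comp cf cg hf hg => rw [ofCode, eval, hf, hg]; rfl
  | prec cf cg hf hg => rw [ofCode, eval, hf, hg]; rfl
  | rfind' cf hf => rw [ofCode, eval, hf]; rfl

/-- `c.Computes O x y` says that `c` with oracle `O` halts on input `x` with output `y`. -/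
def Computes (c : OracleCode) (O : ℕ → ℕ) (x y : ℕ) : Prop := y ∈ c.eval O x

theorem dom_eval_iff {c : OracleCode} {O : ℕ → ℕ} {x : ℕ} :
    (c.eval O x).Dom ↔ ∃ y, c.Computes O x y := Part.dom_iff_mem

section Eval

variable {O : ℕ → ℕ} {cf cg : OracleCode} {a m n y : ℕ}

theorem computes_zero : zero.Computes O n y ↔ y = 0 := Part.mem_some_iff

theorem computes_succ : succ.Computes O n y ↔ y = n + 1 := Part.mem_some_iff

theorem computes_left : left.Computes O n y ↔ y = n.unpair.1 := Part.mem_some_iff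

theorem computes_right : right.Computes O n y ↔ y = n.unpair.2 := Part.mem_some_iff

theorem computes_oracle : oracle.Computes O n y ↔ y = O n := Part.mem_some_iff

theorem computes_pair : (pair cf cg).Computes O n y ↔
    ∃ a b, cf.Computes O n a ∧ cg.Computes O n b ∧ Nat.pair a b = y := by
  have : (pair cf cg).eval O n =
      ((cf.eval O n).map Nat.pair).bind fun f => (cg.eval O n).map f := rfl
  rw [Computes, this]
  simp only [Part.mem_bind_iff, Part.mem_map_iff]
  exact ⟨fun ⟨f, ⟨a, ha, hf⟩, b, hb, h⟩ => ⟨a, b, ha, hb, by rw [hf, h]⟩,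
    fun ⟨a, b, ha, hb, h⟩ => ⟨_, ⟨a, ha, rfl⟩, b, hb, h⟩⟩

theorem computes_comp : (comp cf cg).Computes O n y ↔ ∃ a, cg.Computes O n a ∧ cf.Computes O a y :=
  Part.mem_bind_iff

theorem computes_prec_zero : (prec cf cg).Computes O (Nat.pair a 0) y ↔ cf.Computes O a y := by
  rw [Computes, eval, Nat.unpaired, Nat.unpair_pair]
  exact Iff.rfl

theorem computes_prec_succ : (prec cf cg).Computes O (Nat.pair a (n + 1)) y ↔
    ∃ i, (prec cf cg).Computes O (Nat.pair a n) i ∧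
      cg.Computes O (Nat.pair a (Nat.pair n i)) y := by
  rw [Computes, eval, Nat.unpaired, Nat.unpair_pair]
  simp only [Computes]
  rw [eval, Nat.unpaired, Nat.unpair_pair]
  exact Part.mem_bind_iff

theorem computes_rfind' : (rfind' cf).Computes O (Nat.pair a m) y ↔
    ∃ n, cf.Computes O (Nat.pair a (n + m)) 0 ∧
      (∀ i < n, ∃ v, cf.Computes O (Nat.pair a (i + m)) (v + 1)) ∧ n + m = y := by
  rw [Computes, eval, Nat.unpaired, Nat.unpair_pair, Part.mem_map_iff]
  refine exists_congr fun n => ?_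
  refine (and_congr_left' Nat.mem_rfind).trans ?_
  rw [← and_assoc]
  refine and_congr_left' (and_congr ?_ (forall₂_congr fun i _ => ?_))
  · refine (Part.mem_map_iff _).trans ?_
    simp only [decide_eq_true_eq, exists_eq_right]
    exact Iff.rfl
  · refine (Part.mem_map_iff _).trans ?_
    constructor
    · rintro ⟨v, hv, h⟩
      obtain ⟨w, rfl⟩ := Nat.exists_eq_succ_of_ne_zero (of_decide_eq_false h)
      exact ⟨w, hv⟩
    · rintro ⟨v, hv⟩
      exact ⟨_, hv, by simp⟩

end Eval

theorem exists_code {f : ℕ → ℕ} (hf : Primrec f) :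
    ∃ c : OracleCode, ∀ O n y, c.Computes O n y ↔ y = f n := by
  obtain ⟨c, hc⟩ := Nat.Partrec.Code.exists_code.1
    (Nat.Partrec.of_primrec (Primrec.nat_iff.1 hf))
  exact ⟨ofCode c, fun O n y => by rw [Computes, eval_ofCode, hc]; exact Part.mem_some_iff⟩

theorem exists_code₂ {f : List ℕ → ℕ → ℕ} (hf : Primrec₂ f) :
    ∃ c : OracleCode, ∀ O L n y, c.Computes O (Nat.pair (Encodable.encode L) n) y ↔ y = f L n := by
  obtain ⟨c, hc⟩ := exists_code (f := fun n => f (Denumerable.ofNat _ n.unpair.1) n.unpair.2)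
    (hf.comp ((Primrec.ofNat _).comp (Primrec.fst.comp Primrec.unpair))
      (Primrec.snd.comp Primrec.unpair))
  exact ⟨c, fun O L n => by simp [hc]⟩

theorem exists_code_seg :
    ∃ c : OracleCode, ∀ O n y, c.Computes O n y ↔ y = Encodable.encode (seg O n) := by
  obtain ⟨cn, hn⟩ := exists_code (f := fun _ => Encodable.encode ([] : List ℕ))
    (Primrec.const _)
  obtain ⟨cz, hz⟩ := exists_code (f := fun n => Nat.pair 0 n)
    (Primrec₂.natPair.comp (Primrec.const 0) Primrec.id)
  obtain ⟨ca, ha⟩ := exists_code₂ (f := fun L n => Encodable.encode (L ++ [n]))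
    (Primrec.encode.comp (Primrec.list_concat))
  refine ⟨comp (prec cn (comp ca (pair (comp right right) (comp oracle (comp left right))))) cz,
    fun O n y => ?_⟩
  simp only [computes_comp, hz, exists_eq_left]
  induction n generalizing y with
  | zero => simp [computes_prec_zero, hn]
  | succ n ih =>
    simp [computes_prec_succ, ih, computes_comp, computes_pair, computes_right, computes_left,
      computes_oracle, ha, seg_succ]

/-- Unbounded search over initial segments of the oracle. -/
theorem exists_search {R : List ℕ → ℕ → Prop} {F : List ℕ → ℕ → ℕ} (hR : PrimrecRel R)
    (hF : Primrec₂ F) :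
    ∃ c : OracleCode, ∀ O x y, c.Computes O x y ↔
      ∃ s, R (seg O s) x ∧ (∀ t < s, ¬ R (seg O t) x) ∧ y = F (seg O s) x := by
  classical
  obtain ⟨cs, hs⟩ := exists_code_seg
  obtain ⟨cF, hcF⟩ := exists_code₂ hF
  obtain ⟨cR, hcR⟩ := exists_code₂ (f := fun L n => if R L n then 0 else 1)
    (Primrec.ite hR (Primrec.const 0) (Primrec.const 1))
  obtain ⟨ci, hi⟩ := exists_code (f := fun n => n) Primrec.id
  obtain ⟨cp, hp⟩ := exists_code (f := fun n => Nat.pair n 0)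
    (Primrec₂.natPair.comp Primrec.id (Primrec.const 0))
  refine ⟨comp cF (pair (comp cs (comp (rfind' (comp cR (pair (comp cs right) left))) cp)) ci),
    fun O x y => ?_⟩
  simp only [computes_comp, computes_pair, computes_left, computes_right, hs, hi, hp,
    exists_eq_left, computes_rfind', add_zero, Nat.unpair_pair]
  simp only [hcR, hcF, ↓existsAndEq, and_true, true_and]
  have (t : ℕ) : (∃ v, v + 1 = if R (seg O t) x then 0 else 1) ↔ ¬ R (seg O t) x := by
    split_ifs with h <;> simp [h]
  simp [this, and_assoc]

end OracleCode

namespace OracleCode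

/-- `g L x` approximates the computation of `c` on input `x` using only the finite part `L` of
the oracle. -/
structure Approximates (g : List ℕ → ℕ → Option ℕ) (c : OracleCode) : Prop where
  primrec : Primrec₂ g
  sound : ∀ O s x y, g (seg O s) x = some y → c.Computes O x y
  complete : ∀ O x y, c.Computes O x y → ∀ᶠ s in atTop, g (seg O s) x = some y

theorem Approximates.of_primrec {f : ℕ → ℕ} {c : OracleCode} (hf : Primrec f)
    (hc : ∀ O x y, c.Computes O x y ↔ y = f x) : Approximates (fun _ x => some (f x)) c where
  primrec := Primrec.option_some.comp (hf.comp Primrec.snd)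
  sound O s x y h := (hc O x y).2 (Option.some.inj h).symm
  complete O x y h := by simp [(hc O x y).1 h]

theorem approximates_oracle : Approximates (fun L x => L[x]?) oracle where
  primrec := Primrec.list_getElem?
  sound O s x y h := by
    rw [getElem?_seg] at h
    split_ifs at h
    exact computes_oracle.2 (Option.some.inj h).symm
  complete O x y h := by
    filter_upwards [eventually_gt_atTop x] with s hs
    rw [getElem?_seg, if_pos hs, computes_oracle.1 h]

variable {f g : List ℕ → ℕ → Option ℕ} {cf cg : OracleCode}

theorem Approximates.pair (hf : Approximates f cf) (hg : Approximates g cg) :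
    Approximates (fun L x => (f L x).bind fun a => (g L x).map (Nat.pair a)) (cf.pair cg) where
  primrec := Primrec.option_bind hf.primrec
    (Primrec.option_map (hg.primrec.comp (Primrec.fst.comp Primrec.fst)
      (Primrec.snd.comp Primrec.fst))
      (Primrec₂.natPair.comp (Primrec.snd.comp Primrec.fst) Primrec.snd))
  sound O s x y h := by
    simp only [Option.bind_eq_some_iff, Option.map_eq_some_iff] at h
    obtain ⟨a, ha, b, hb, h⟩ := h
    exact computes_pair.2 ⟨a, b, hf.sound _ _ _ _ ha, hg.sound _ _ _ _ hb, h⟩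
  complete O x y h := by
    obtain ⟨a, b, ha, hb, h⟩ := computes_pair.1 h
    filter_upwards [hf.complete _ _ _ ha, hg.complete _ _ _ hb] with s h1 h2
    simp [h1, h2, h]

theorem Approximates.comp (hf : Approximates f cf) (hg : Approximates g cg) :
    Approximates (fun L x => (g L x).bind fun a => f L a) (cf.comp cg) where
  primrec := Primrec.option_bind hg.primrec
    (hf.primrec.comp (Primrec.fst.comp Primrec.fst) Primrec.snd)
  sound O s x y h := by
    simp only [Option.bind_eq_some_iff] at h
    obtain ⟨a, ha, h⟩ := h
    exact computes_comp.2 ⟨a, hg.sound _ _ _ _ ha, hf.sound _ _ _ _ h⟩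
  complete O x y h := by
    obtain ⟨a, ha, h⟩ := computes_comp.1 h
    filter_upwards [hg.complete _ _ _ ha, hf.complete _ _ _ h] with s h1 h2
    simp [h1, h2]

theorem Approximates.prec (hf : Approximates f cf) (hg : Approximates g cg) :
    Approximates (fun L x => x.unpair.2.rec (f L x.unpair.1) fun y IH =>
      IH.bind fun i => g L (Nat.pair x.unpair.1 (Nat.pair y i))) (cf.prec cg) where
  primrec := by
    have h1 : Primrec fun p : List ℕ × ℕ => p.2.unpair.1 :=
      Primrec.fst.comp (Primrec.unpair.comp Primrec.snd)
    have h2 : Primrec fun p : List ℕ × ℕ => p.2.unpair.2 :=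
      Primrec.snd.comp (Primrec.unpair.comp Primrec.snd)
    refine Primrec.nat_rec' (f := fun p : List ℕ × ℕ => p.2.unpair.2)
      (g := fun p : List ℕ × ℕ => f p.1 p.2.unpair.1)
      (h := fun (p : List ℕ × ℕ) (q : ℕ × Option ℕ) =>
        q.2.bind fun i => g p.1 (Nat.pair p.2.unpair.1 (Nat.pair q.1 i)))
      h2 (hf.primrec.comp Primrec.fst h1) ?_
    refine Primrec.option_bind (Primrec.snd.comp Primrec.snd) ?_
    refine hg.primrec.comp (Primrec.fst.comp (Primrec.fst.comp Primrec.fst)) ?_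
    exact Primrec₂.natPair.comp (h1.comp (Primrec.fst.comp Primrec.fst))
      (Primrec₂.natPair.comp (Primrec.fst.comp (Primrec.snd.comp Primrec.fst)) Primrec.snd)
  sound O s x y h := by
    obtain ⟨a, n, rfl⟩ : ∃ a n, x = Nat.pair a n := ⟨_, _, (Nat.pair_unpair x).symm⟩
    simp only [Nat.unpair_pair] at h
    induction n generalizing y with
    | zero => exact computes_prec_zero.2 (hf.sound _ _ _ _ h)
    | succ n ih =>
      simp only [Option.bind_eq_some_iff] at h
      obtain ⟨i, hi, h⟩ := h
      exact computes_prec_succ.2 ⟨i, ih _ hi, hg.sound _ _ _ _ h⟩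
  complete O x y h := by
    obtain ⟨a, n, rfl⟩ : ∃ a n, x = Nat.pair a n := ⟨_, _, (Nat.pair_unpair x).symm⟩
    simp only [Nat.unpair_pair]
    induction n generalizing y with
    | zero => exact hf.complete _ _ _ (computes_prec_zero.1 h)
    | succ n ih =>
      obtain ⟨i, hi, h⟩ := computes_prec_succ.1 h
      filter_upwards [ih _ hi, hg.complete _ _ _ h] with s h1 h2
      simp [h1, h2]

/-- The least `n` at most `k` such that `p n` fails, if any, and `k` otherwise. -/
def scan (p : ℕ → Bool) (k : ℕ) : ℕ := k.rec 0 fun _ n => bif p n then n + 1 else n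

theorem scan_spec (p : ℕ → Bool) (k : ℕ) : ∀ i < scan p k, p i = true := by
  induction k with
  | zero => simp [scan]
  | succ k ih =>
    intro i hi
    change i < bif p (scan p k) then scan p k + 1 else scan p k at hi
    cases h : p (scan p k) with
    | false => exact ih i (by simpa [h] using hi)
    | true =>
      rw [h, cond_true] at hi
      rcases Nat.lt_succ_iff_lt_or_eq.1 hi with hi | rfl
      exacts [ih i hi, h]

theorem scan_eq (p : ℕ → Bool) (n k : ℕ) (h : ∀ i < n, p i = true) (hn : p n = false) :
    scan p k = min k n := by
  induction k with
  | zero => simp [scan]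
  | succ k ih =>
    change (bif p (scan p k) then scan p k + 1 else scan p k) = _
    rw [ih]
    rcases lt_or_ge k n with hk | hk
    · rw [min_eq_left hk.le, h k hk, min_eq_left (by omega), cond_true]
    · rw [min_eq_right hk, hn, min_eq_right (by omega), cond_false]

theorem primrec_scan {α : Type*} [Primcodable α] {p : α → ℕ → Bool} {k : α → ℕ}
    (hp : Primrec₂ p) (hk : Primrec k) : Primrec fun a => scan (p a) (k a) :=
  Primrec.nat_rec' (h := fun a (q : ℕ × ℕ) => bif p a q.2 then q.2 + 1 else q.2) hk
    (Primrec.const 0)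
    (Primrec.cond (hp.comp Primrec.fst (Primrec.snd.comp Primrec.snd))
      (Primrec.succ.comp (Primrec.snd.comp Primrec.snd)) (Primrec.snd.comp Primrec.snd))

theorem Approximates.rfind' (hf : Approximates f cf) :
    Approximates (fun L x =>
      let v := fun i => f L (Nat.pair x.unpair.1 (i + x.unpair.2))
      let n := scan (fun i => decide (0 < (v i).getD 0)) L.length
      bif decide (v n = some 0) then some (n + x.unpair.2) else none) cf.rfind' where
  primrec := by
    have h1 : Primrec fun p : List ℕ × ℕ => p.2.unpair.1 :=
      Primrec.fst.comp (Primrec.unpair.comp Primrec.snd)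
    have h2 : Primrec fun p : List ℕ × ℕ => p.2.unpair.2 :=
      Primrec.snd.comp (Primrec.unpair.comp Primrec.snd)
    have hv : Primrec₂ fun (p : List ℕ × ℕ) (i : ℕ) =>
        f p.1 (Nat.pair p.2.unpair.1 (i + p.2.unpair.2)) :=
      hf.primrec.comp (Primrec.fst.comp Primrec.fst)
        (Primrec₂.natPair.comp (h1.comp Primrec.fst)
          (Primrec.nat_add.comp Primrec.snd (h2.comp Primrec.fst)))
    have hn : Primrec fun p : List ℕ × ℕ => scan (fun i => decide
        (0 < (f p.1 (Nat.pair p.2.unpair.1 (i + p.2.unpair.2))).getD 0)) p.1.length :=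
      primrec_scan (Primrec.nat_lt.decide.comp (Primrec.const 0)
        (Primrec.option_getD.comp hv (Primrec.const 0))) (Primrec.list_length.comp Primrec.fst)
    exact Primrec.cond (Primrec.eq.decide.comp (hv.comp Primrec.id hn) (Primrec.const _))
      (Primrec.option_some.comp (Primrec.nat_add.comp hn h2)) (Primrec.const _)
  sound O s x y h := by
    obtain ⟨a, m, rfl⟩ : ∃ a n, x = Nat.pair a n := ⟨_, _, (Nat.pair_unpair x).symm⟩
    simp only [Nat.unpair_pair, length_seg] at h
    set p := fun i => decide (0 < (f (seg O s) (Nat.pair a (i + m))).getD 0) with hp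
    rw [Bool.cond_decide] at h
    split_ifs at h with h0
    refine computes_rfind'.2 ⟨_, hf.sound _ _ _ _ h0, fun i hi => ?_, Option.some.inj h⟩
    have := scan_spec p s i hi
    rw [hp, decide_eq_true_eq] at this
    obtain ⟨v, hv⟩ : ∃ v, f (seg O s) (Nat.pair a (i + m)) = some (v + 1) := by
      cases hfi : f (seg O s) (Nat.pair a (i + m)) with
      | none => simp [hfi] at this
      | some w =>
        rw [hfi, Option.getD_some] at this
        exact ⟨w - 1, by rw [Nat.sub_add_cancel this]⟩
    exact ⟨v, hf.sound _ _ _ _ hv⟩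
  complete O x y h := by
    obtain ⟨a, m, rfl⟩ : ∃ a n, x = Nat.pair a n := ⟨_, _, (Nat.pair_unpair x).symm⟩
    obtain ⟨n, h0, hi, rfl⟩ := computes_rfind'.1 h
    choose! v hv using hi
    have hall : ∀ᶠ s in atTop, ∀ i < n, f (seg O s) (Nat.pair a (i + m)) = some (v i + 1) :=
      (Set.finite_lt_nat n).eventually_all.2 fun i hi => hf.complete _ _ _ (hv i hi)
    filter_upwards [hall, hf.complete _ _ _ h0, eventually_ge_atTop n] with s h1 h2 h3
    simp only [Nat.unpair_pair, length_seg]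
    rw [scan_eq _ n s (fun i hi => by simp [h1 i hi]) (by simp [h2]), min_eq_right h3]
    simp [h2]

/-- The normal form theorem for oracle computations. -/
theorem exists_approximates (c : OracleCode) : ∃ g, Approximates g c := by
  induction c with
  | zero => exact ⟨_, .of_primrec (Primrec.const 0) fun O x y => computes_zero⟩
  | succ => exact ⟨_, .of_primrec Primrec.succ fun O x y => computes_succ⟩
  | left => exact ⟨_, .of_primrec (Primrec.fst.comp Primrec.unpair) fun O x y => computes_left⟩
  | right => exact ⟨_, .of_primrec (Primrec.snd.comp Primrec.unpair) fun O x y => computes_right⟩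
  | oracle => exact ⟨_, approximates_oracle⟩
  | pair cf cg hf hg => exact ⟨_, hf.choose_spec.pair hg.choose_spec⟩
  | comp cf cg hf hg => exact ⟨_, hf.choose_spec.comp hg.choose_spec⟩
  | prec cf cg hf hg => exact ⟨_, hf.choose_spec.prec hg.choose_spec⟩
  | rfind' cf hf => exact ⟨_, hf.choose_spec.rfind'⟩

end OracleCode

theorem mem_evalStr {c : OracleCode} {O : ℕ → ℕ} {σ τ : List Bool} : τ ∈ evalStr c O σ ↔
    ∃ m, c.Computes O (Encodable.encode σ) m ∧ Encodable.decode m = some τ := by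
  simp only [evalStr, Part.mem_bind_iff, Part.mem_ofOption]
  exact Iff.rfl

theorem primrecPred_exists_lt {α : Type*} [Primcodable α] {S : ℕ → α → Prop} (hS : PrimrecRel S)
    {f : α → ℕ} (hf : Primrec f) : PrimrecPred fun a => ∃ k < f a, S k a := by
  have h := hS.exists_mem_list
  exact (h.comp (Primrec.list_range.comp hf) Primrec.id).of_eq (by simp)

theorem primrecPred_forall_lt {α : Type*} [Primcodable α] {S : ℕ → α → Prop} (hS : PrimrecRel S)
    {f : α → ℕ} (hf : Primrec f) : PrimrecPred fun a => ∀ k < f a, S k a := by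
  have h := hS.forall_mem_list
  exact (h.comp (Primrec.list_range.comp hf) Primrec.id).of_eq (by simp)

/-- `P` is recursively enumerable in the oracle `O`. -/
def REIn (O : ℕ → ℕ) {α : Type*} [Primcodable α] (P : α → Prop) : Prop :=
  ∃ R : List ℕ → α → Prop, PrimrecRel R ∧ ∀ a, P a ↔ ∃ s, R (seg O s) a

namespace REIn

variable {O : ℕ → ℕ} {α β : Type*} [Primcodable α] [Primcodable β]

theorem of_primrecPred {P : α → Prop} (h : PrimrecPred P) : REIn O P :=
  ⟨fun _ a => P a, h.comp Primrec.snd, fun a => by simp⟩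

theorem comp {P : β → Prop} (h : REIn O P) {f : α → β} (hf : Primrec f) :
    REIn O fun a => P (f a) := by
  obtain ⟨R, hR, h⟩ := h
  exact ⟨fun L a => R L (f a), hR.comp Primrec.fst (hf.comp Primrec.snd), fun a => h _⟩

theorem of_iff {P Q : α → Prop} (h : REIn O P) (hPQ : ∀ a, P a ↔ Q a) : REIn O Q := by
  rwa [show Q = P from funext fun a => propext (hPQ a).symm]

theorem exists_mono {P : α → Prop} (h : REIn O P) :
    ∃ R : List ℕ → α → Prop, PrimrecRel R ∧
      (∀ s t a, s ≤ t → R (seg O s) a → R (seg O t) a) ∧ ∀ a, P a ↔ ∃ s, R (seg O s) a := by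
  obtain ⟨R, hR, h⟩ := h
  have key : ∀ s a, (∃ k < (seg O s).length + 1, R ((seg O s).take k) a) ↔
      ∃ k ≤ s, R (seg O k) a := by
    intro s a
    simp only [length_seg, Nat.lt_succ_iff]
    refine exists_congr fun k => and_congr_right fun hk => by rw [take_seg_of_le O hk]
  refine ⟨fun L a => ∃ k < L.length + 1, R (L.take k) a, ?_, ?_, ?_⟩
  · have : PrimrecRel fun (k : ℕ) (p : List ℕ × α) => R (p.1.take k) p.2 :=
      hR.comp (Primrec.list_take.comp Primrec.fst (Primrec.fst.comp Primrec.snd))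
        (Primrec.snd.comp Primrec.snd)
    have h' : PrimrecPred fun p : List ℕ × α => ∃ k < p.1.length + 1, R (p.1.take k) p.2 :=
      primrecPred_exists_lt this (Primrec.succ.comp (Primrec.list_length.comp Primrec.fst))
    exact h'
  · intro s t a hst
    beta_reduce
    rw [key, key]
    exact fun ⟨k, hk, h⟩ => ⟨k, hk.trans hst, h⟩
  · intro a
    simp only [key, h]
    exact ⟨fun ⟨s, hs⟩ => ⟨s, s, le_rfl, hs⟩, fun ⟨_, k, _, hk⟩ => ⟨k, hk⟩⟩

theorem and {P Q : α → Prop} (hP : REIn O P) (hQ : REIn O Q) : REIn O fun a => P a ∧ Q a := by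
  obtain ⟨R, hR, hRm, hP⟩ := hP.exists_mono
  obtain ⟨S, hS, hSm, hQ⟩ := hQ.exists_mono
  refine ⟨fun L a => R L a ∧ S L a, PrimrecPred.and hR hS, fun a => ?_⟩
  beta_reduce
  rw [hP, hQ]
  exact ⟨fun ⟨⟨s, hs⟩, t, ht⟩ => ⟨max s t, hRm _ _ _ (le_max_left _ _) hs,
    hSm _ _ _ (le_max_right _ _) ht⟩, fun ⟨s, hs, ht⟩ => ⟨⟨s, hs⟩, s, ht⟩⟩

theorem ex {P : α × β → Prop} (hP : REIn O P) : REIn O fun a => ∃ b, P (a, b) := by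
  obtain ⟨R, hR, hRm, hP⟩ := hP.exists_mono
  let S : ℕ → List ℕ × α → Prop := fun k p =>
    ∃ b ∈ (Encodable.decode (α := β) k).toList, R p.1 (p.2, b)
  have hS : PrimrecRel S := by
    have : PrimrecRel fun (b : β) (p : List ℕ × α) => R p.1 (p.2, b) :=
      hR.comp (Primrec.fst.comp Primrec.snd)
        (Primrec.pair (Primrec.snd.comp Primrec.snd) Primrec.fst)
    exact this.exists_mem_list.comp
      (Primrec.optionToList.comp (Primrec.decode.comp Primrec.fst)) Primrec.snd
  have hS' : PrimrecPred fun p : List ℕ × α => ∃ k < p.1.length, S k p :=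
    primrecPred_exists_lt hS (Primrec.list_length.comp Primrec.fst)
  refine ⟨fun L a => ∃ k < L.length, S k (L, a), hS', fun a => ?_⟩
  simp only [length_seg, hP, S, Option.mem_toList]
  constructor
  · rintro ⟨b, s, hs⟩
    exact ⟨max s (Encodable.encode b + 1), Encodable.encode b, by simp, b, by simp,
      hRm _ _ _ (le_max_left _ _) hs⟩
  · rintro ⟨s, k, _, b, _, hb⟩
    exact ⟨b, s, hb⟩

theorem forall_mem {P : α → Prop} (hP : REIn O P) : REIn O fun l : List α => ∀ a ∈ l, P a := by
  obtain ⟨R, hR, hRm, hP⟩ := hP.exists_mono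
  refine ⟨fun L l => ∀ a ∈ l, R L a,
    hR.swap.forall_mem_list.comp Primrec.snd Primrec.fst, fun l => ?_⟩
  constructor
  · intro h
    have h' : ∀ a ∈ l, ∃ s, R (seg O s) a := fun a ha => (hP a).1 (h a ha)
    choose! s hs using h'
    have hf : ∀ᶠ t in atTop, ∀ a ∈ l, s a ≤ t := by
      have := (List.finite_toSet l).eventually_all (l := atTop)
        (p := fun a t => s a ≤ t)
      exact this.2 fun a _ => eventually_ge_atTop _
    obtain ⟨t, ht⟩ := hf.exists
    exact ⟨t, fun a ha => hRm _ _ _ (ht a ha) (hs a ha)⟩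
  · rintro ⟨s, hs⟩ a ha
    exact (hP a).2 ⟨s, hs a ha⟩

theorem computes (c : OracleCode) : REIn O fun p : ℕ × ℕ => c.Computes O p.1 p.2 := by
  obtain ⟨g, hg⟩ := c.exists_approximates
  refine ⟨fun L p => g L p.1 = some p.2, Primrec.eq.comp
    (hg.primrec.comp Primrec.fst (Primrec.fst.comp Primrec.snd))
    (Primrec.option_some.comp (Primrec.snd.comp Primrec.snd)), fun p => ?_⟩
  exact ⟨fun h => (hg.complete _ _ _ h).exists, fun ⟨s, hs⟩ => hg.sound _ _ _ _ hs⟩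

theorem dom (c : OracleCode) : REIn O fun x : ℕ => (c.eval O x).Dom :=
  (computes c).ex.of_iff fun _ => OracleCode.dom_eval_iff.symm

theorem evalStr (c : OracleCode) :
    REIn O fun p : List Bool × List Bool => p.2 ∈ evalStr c O p.1 := by
  have : REIn O fun p : (List Bool × List Bool) × ℕ =>
      c.Computes O (Encodable.encode p.1.1) p.2 ∧ Encodable.decode p.2 = some p.1.2 :=
    ((computes c).comp (Primrec.pair (Primrec.encode.comp (Primrec.fst.comp Primrec.fst))
      Primrec.snd)).and (of_primrecPred (Primrec.eq.comp (Primrec.decode.comp Primrec.snd)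
        (Primrec.option_some.comp (Primrec.snd.comp Primrec.fst))))
  exact this.ex.of_iff fun p => (mem_evalStr (c := c) (O := O) (σ := p.1) (τ := p.2)).symm

theorem exists_code {P : α → Prop} (hP : REIn O P) :
    ∃ c : OracleCode, ∀ a, P a ↔ (c.eval O (Encodable.encode a)).Dom := by
  obtain ⟨R, hR, hP⟩ := hP
  obtain ⟨c, hc⟩ := OracleCode.exists_search
    (R := fun L x => ∃ a ∈ (Encodable.decode (α := α) x).toList, R L a) (F := fun _ _ => 0)
    (hR.swap.exists_mem_list.comp (Primrec.optionToList.comp (Primrec.decode.comp Primrec.snd))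
      Primrec.fst) (Primrec₂.const 0)
  refine ⟨c, fun a => ?_⟩
  simp only [OracleCode.dom_eval_iff, hc, hP, Encodable.encodek, Option.mem_toList,
    Option.some.injEq, exists_eq_left']
  classical
  constructor
  · intro h
    exact ⟨0, Nat.find h, Nat.find_spec h, fun t ht => Nat.find_min h ht, rfl⟩
  · rintro ⟨_, s, hs, _⟩
    exact ⟨s, hs⟩

end REIn

theorem primrec_pow : Primrec₂ fun a b : ℕ => a ^ b :=
  Primrec₂.unpaired'.1 Nat.Primrec.pow

/-- The natural number with binary expansion `σ`. -/
def val (σ : List Bool) : ℕ := σ.foldl (fun v b => 2 * v + b.toNat) 0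

@[simp] theorem val_nil : val [] = 0 := rfl

theorem val_concat (σ : List Bool) (b : Bool) : val (σ ++ [b]) = 2 * val σ + b.toNat := by
  simp [val]

theorem val_append (σ ρ : List Bool) : val (σ ++ ρ) = val σ * 2 ^ ρ.length + val ρ := by
  induction ρ using List.reverseRecOn with
  | nil => simp
  | append_singleton ρ b ih =>
    rw [← List.append_assoc, val_concat, ih, val_concat, List.length_append, List.length_singleton]
    ring

theorem val_lt (σ : List Bool) : val σ < 2 ^ σ.length := by
  induction σ using List.reverseRecOn with
  | nil => simp
  | append_singleton σ b ih =>
    rw [val_concat, List.length_append, List.length_singleton, pow_succ]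
    have := b.toNat_lt
    omega

theorem exists_val_eq (n v : ℕ) (h : v < 2 ^ n) : ∃ σ : List Bool, σ.length = n ∧ val σ = v := by
  induction n generalizing v with
  | zero => exact ⟨[], rfl, by rw [pow_zero] at h; rw [val_nil]; omega⟩
  | succ n ih =>
    rw [pow_succ] at h
    obtain ⟨σ, hσ, hv⟩ := ih (v / 2) (by omega)
    refine ⟨σ ++ [decide (v % 2 = 1)], by simp [hσ], ?_⟩
    rw [val_concat, hv]
    by_cases h2 : v % 2 = 1
    · simp only [h2, decide_true, Bool.toNat_true]; omega
    · simp only [h2, decide_false, Bool.toNat_false]; omega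

theorem primrec_val : Primrec val := by
  have hb : Primrec Bool.toNat :=
    (Primrec.cond Primrec.id (Primrec.const 1) (Primrec.const 0)).of_eq
    fun b => by cases b <;> rfl
  exact Primrec.list_foldl Primrec.id (Primrec.const 0)
    (Primrec.nat_add.comp (Primrec.nat_mul.comp (Primrec.const 2) (Primrec.fst.comp Primrec.snd))
      (hb.comp (Primrec.snd.comp Primrec.snd))).to₂

/-- The left endpoint of the dyadic interval of a string. -/
noncomputable def lo (σ : List Bool) : ℝ := val σ / 2 ^ σ.length

theorem lo_append (σ ρ : List Bool) : lo (σ ++ ρ) = lo σ + lo ρ / 2 ^ σ.length := by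
  simp only [lo, val_append, List.length_append, Nat.cast_add, Nat.cast_mul, Nat.cast_pow,
    Nat.cast_ofNat, pow_add]
  field_simp

theorem lo_nonneg (σ : List Bool) : 0 ≤ lo σ := by unfold lo; positivity

theorem lo_lt_one (σ : List Bool) : lo σ < 1 := by
  rw [lo, div_lt_one (by positivity)]
  exact_mod_cast val_lt σ

theorem lo_bounds_of_prefix {σ ρ : List Bool} (h : σ <+: ρ) :
    lo σ ≤ lo ρ ∧ lo ρ < lo σ + 1 / 2 ^ σ.length := by
  obtain ⟨τ, rfl⟩ := h
  rw [lo_append]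
  constructor
  · have := lo_nonneg τ
    have : 0 ≤ lo τ / 2 ^ σ.length := by positivity
    linarith
  · have := lo_lt_one τ
    gcongr

/-- Partial sums of the weights `2⁻ᵃ` of a sequence of requests, as a fraction `(x, m)` standing
for `x / 2 ^ m`. -/
def dyadicSum (e : ℕ → Option ℕ) : ℕ → ℕ × ℕ
  | 0 => (0, 0)
  | k + 1 => (e k).elim (dyadicSum e k) fun l =>
      ((dyadicSum e k).1 * 2 ^ l + 2 ^ (dyadicSum e k).2, (dyadicSum e k).2 + l)

theorem dyadicSum_congr {e e' : ℕ → Option ℕ} {k : ℕ} (h : ∀ i < k, e i = e' i) :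
    dyadicSum e k = dyadicSum e' k := by
  induction k with
  | zero => rfl
  | succ k ih => rw [dyadicSum, dyadicSum, ih fun i hi => h i (hi.trans k.lt_succ_self),
      h k k.lt_succ_self]

/-- The weight of an optional request. -/
noncomputable def weight (o : Option ℕ) : ℝ := o.elim 0 fun l => 1 / 2 ^ l

theorem weight_some (l : ℕ) : weight (some l) = 1 / 2 ^ l := rfl

theorem weight_nonneg (o : Option ℕ) : 0 ≤ weight o := by
  cases o <;> simp [weight]

theorem dyadicSum_eq (e : ℕ → Option ℕ) (k : ℕ) :
    ((dyadicSum e k).1 : ℝ) = (∑ i ∈ Finset.range k, weight (e i)) * 2 ^ (dyadicSum e k).2 := by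
  induction k with
  | zero => simp [dyadicSum]
  | succ k ih =>
    rw [dyadicSum, Finset.sum_range_succ]
    cases e k with
    | none => simpa [weight] using ih
    | some l =>
      simp only [Option.elim, weight, Nat.cast_add, Nat.cast_mul, ih, Nat.cast_pow,
        Nat.cast_ofNat, pow_add]
      field_simp

/-- The string `σ` is allotted to the request made at step `k`. -/
def Allotted (e : ℕ → Option ℕ) (k : ℕ) (σ : List Bool) : Prop :=
  e k = some (σ.length - 1) ∧ 0 < σ.length ∧
    (dyadicSum e k).1 * 2 ^ σ.length ≤ val σ * 2 ^ (dyadicSum e k).2 ∧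
    (val σ + 1) * 2 ^ (dyadicSum e k).2 ≤
      (dyadicSum e k).1 * 2 ^ σ.length + 2 ^ ((dyadicSum e k).2 + 1)

theorem Allotted.congr {e e' : ℕ → Option ℕ} {k : ℕ} (h : ∀ i ≤ k, e i = e' i) (σ : List Bool) :
    Allotted e k σ ↔ Allotted e' k σ := by
  rw [Allotted, Allotted, dyadicSum_congr fun i hi => h i hi.le, h k le_rfl]

section Allotted

variable {e : ℕ → Option ℕ} {k l : ℕ} {σ ρ : List Bool}

theorem Allotted.bounds (h : Allotted e k σ) :
    ∑ i ∈ Finset.range k, weight (e i) ≤ lo σ ∧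
      lo σ + 1 / 2 ^ σ.length ≤ ∑ i ∈ Finset.range (k + 1), weight (e i) := by
  obtain ⟨h0, h1, h2, h3⟩ := h
  have h2' : ((dyadicSum e k).1 : ℝ) * 2 ^ σ.length ≤ val σ * 2 ^ (dyadicSum e k).2 := by
    exact_mod_cast h2
  have h3' : ((val σ : ℝ) + 1) * 2 ^ (dyadicSum e k).2 ≤
      (dyadicSum e k).1 * 2 ^ σ.length + 2 ^ ((dyadicSum e k).2 + 1) := by exact_mod_cast h3
  have hp : (0 : ℝ) < 2 ^ (dyadicSum e k).2 := by positivity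
  rw [dyadicSum_eq] at h2' h3'
  rw [Finset.sum_range_succ, h0]
  obtain ⟨n, hn⟩ : ∃ n, σ.length = n + 1 := ⟨σ.length - 1, by omega⟩
  simp only [lo, weight_some, hn, Nat.add_sub_cancel] at h2' h3' ⊢
  set q := ∑ i ∈ Finset.range k, weight (e i)
  constructor
  · rw [le_div_iff₀ (by positivity)]
    nlinarith
  · rw [← add_div, div_le_iff₀ (by positivity)]
    have : (q + 1 / 2 ^ n) * 2 ^ (n + 1) = q * 2 ^ (n + 1) + 2 := by
      rw [pow_succ]; field_simp
    rw [this]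
    rw [pow_succ (2 : ℝ) (dyadicSum e k).2] at h3'
    nlinarith

theorem exists_allotted (he : e k = some l)
    (h : ∑ i ∈ Finset.range (k + 1), weight (e i) ≤ 1) :
    ∃ σ, σ.length = l + 1 ∧ Allotted e k σ := by
  rw [Finset.sum_range_succ, he] at h
  have hd := dyadicSum_eq e k
  set q := ∑ i ∈ Finset.range k, weight (e i)
  have hq : 0 ≤ q := Finset.sum_nonneg fun i _ => weight_nonneg _
  rw [weight_some] at h
  have hp : (0 : ℝ) < 2 ^ (l + 1) := by positivity
  have hm : (0 : ℝ) < 2 ^ (dyadicSum e k).2 := by positivity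
  set v := ⌈q * 2 ^ (l + 1)⌉₊
  have hv1 : q * 2 ^ (l + 1) ≤ v := Nat.le_ceil _
  have hv2 : (v : ℝ) < q * 2 ^ (l + 1) + 1 := Nat.ceil_lt_add_one (by positivity)
  have hlt : v < 2 ^ (l + 1) := by
    have h' : (q + 1 / 2 ^ l) * 2 ^ (l + 1) ≤ 1 * 2 ^ (l + 1) := by gcongr
    have : (q + 1 / 2 ^ l) * 2 ^ (l + 1) = q * 2 ^ (l + 1) + 2 := by
      rw [pow_succ]; field_simp
    have : (v : ℝ) < 2 ^ (l + 1) := by linarith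
    exact_mod_cast this
  obtain ⟨σ, hσ, hv⟩ := exists_val_eq _ _ hlt
  refine ⟨σ, hσ, by rw [hσ]; simpa using he, by omega, ?_, ?_⟩
  · have : ((dyadicSum e k).1 : ℝ) * 2 ^ σ.length ≤ val σ * 2 ^ (dyadicSum e k).2 := by
      rw [hd, hv, hσ]; nlinarith
    exact_mod_cast this
  · have : ((val σ : ℝ) + 1) * 2 ^ (dyadicSum e k).2 ≤
        (dyadicSum e k).1 * 2 ^ σ.length + 2 ^ ((dyadicSum e k).2 + 1) := by
      rw [hd, hv, hσ, pow_succ (2 : ℝ) (dyadicSum e k).2]; nlinarith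
    exact_mod_cast this

theorem Allotted.eq_of_prefix (hσ : Allotted e k σ) (hρ : Allotted e l ρ) (h : σ <+: ρ) :
    k = l ∧ σ = ρ := by
  have hmono : Monotone fun k => ∑ i ∈ Finset.range k, weight (e i) :=
    monotone_nat_of_le_succ fun n => by
      rw [Finset.sum_range_succ]; linarith [weight_nonneg (e n)]
  obtain ⟨h1, h2⟩ := lo_bounds_of_prefix h
  obtain ⟨h3, h4⟩ := hσ.bounds
  obtain ⟨h5, h6⟩ := hρ.bounds
  have hp : (0 : ℝ) < 1 / 2 ^ ρ.length := by positivity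
  have hkl : k = l := by
    rcases lt_trichotomy k l with hkl | hkl | hkl
    · have := hmono (Nat.succ_le_of_lt hkl)
      simp only [Nat.succ_eq_add_one] at this
      linarith
    · exact hkl
    · have := hmono (Nat.succ_le_of_lt hkl)
      simp only [Nat.succ_eq_add_one] at this
      linarith
  subst hkl
  refine ⟨rfl, h.eq_of_length ?_⟩
  have := Option.some.inj (hσ.1.symm.trans hρ.1)
  have := hσ.2.1
  have := hρ.2.1
  omega

end Allotted

section Requests

variable {α : Type*} [Primcodable α] {R : List ℕ → α → Prop} {len : α → ℕ} {O : ℕ → ℕ}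

open scoped Classical in
/-- The request made after seeing the initial segment `L` of the oracle: the coded element `a`
is requested when the coded stage is the first one at which `R` holds of `a`. -/
noncomputable def request (R : List ℕ → α → Prop) (L : List ℕ) : Option α :=
  (Encodable.decode L.length.unpair.2).bind fun a =>
    if Encodable.encode a = L.length.unpair.2 ∧ R (L.take L.length.unpair.1) a ∧
      ∀ k < L.length.unpair.1, ¬ R (L.take k) a then some a else none

theorem request_eq_some {L : List ℕ} {a : α} : request R L = some a ↔
    Encodable.encode a = L.length.unpair.2 ∧ R (L.take L.length.unpair.1) a ∧
      ∀ k < L.length.unpair.1, ¬ R (L.take k) a := by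
  rw [request, Option.bind_eq_some_iff]
  constructor
  · rintro ⟨b, -, hb⟩
    split_ifs at hb with h
    exact Option.some.inj hb ▸ h
  · intro h
    exact ⟨a, by rw [← h.1, Encodable.encodek], if_pos h⟩

theorem primrec_request (hR : PrimrecRel R) : Primrec (request R) := by
  classical
  have hlen : Primrec fun p : List ℕ × α => p.1.length.unpair :=
    Primrec.unpair.comp (Primrec.list_length.comp Primrec.fst)
  have hS : PrimrecRel fun (k : ℕ) (p : List ℕ × α) => ¬ R (p.1.take k) p.2 :=
    PrimrecPred.not (hR.comp (Primrec.list_take.comp Primrec.fst (Primrec.fst.comp Primrec.snd))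
      (Primrec.snd.comp Primrec.snd))
  refine Primrec.option_bind (Primrec.decode.comp
    (Primrec.snd.comp (Primrec.unpair.comp Primrec.list_length))) ?_
  refine Primrec.ite (PrimrecPred.and (Primrec.eq.comp (Primrec.encode.comp Primrec.snd)
    (Primrec.snd.comp hlen)) (PrimrecPred.and (hR.comp (Primrec.list_take.comp
      (Primrec.fst.comp hlen) Primrec.fst) Primrec.snd)
    (primrecPred_forall_lt hS (Primrec.fst.comp hlen)))) ?_ ?_
  · exact Primrec.option_some.comp Primrec.snd
  · exact Primrec.const none

theorem request_inj {t t' : ℕ} {a : α} (h : request R (seg O t) = some a)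
    (h' : request R (seg O t') = some a) : t = t' := by
  simp only [request_eq_some, length_seg] at h h'
  have h1 : t.unpair.1 = t'.unpair.1 := by
    have hle := Nat.unpair_left_le t
    have hle' := Nat.unpair_left_le t'
    by_contra hne
    rcases lt_or_gt_of_ne hne with hlt | hlt
    · refine h'.2.2 _ hlt ?_
      have := h.2.1
      rwa [take_seg_of_le _ hle, ← take_seg_of_le O (hlt.le.trans hle')] at this
    · refine h.2.2 _ hlt ?_
      have := h'.2.1
      rwa [take_seg_of_le _ hle', ← take_seg_of_le O (hlt.le.trans hle)] at this
  rw [← Nat.pair_unpair t, ← Nat.pair_unpair t', h1, ← h.1, ← h'.1]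

theorem exists_request {a : α} (h : ∃ s, R (seg O s) a) : ∃ t, request R (seg O t) = some a := by
  classical
  refine ⟨Nat.pair (Nat.find h) (Encodable.encode a), request_eq_some.2 ?_⟩
  have hle := Nat.left_le_pair (Nat.find h) (Encodable.encode a)
  simp only [length_seg, Nat.unpair_pair]
  refine ⟨trivial, ?_, fun k hk => ?_⟩
  · rw [take_seg_of_le _ hle]; exact Nat.find_spec h
  · rw [take_seg_of_le _ (hk.le.trans hle)]; exact Nat.find_min h hk

/-- The lengths requested along the initial segments of `L`. -/
noncomputable def requestLen (R : List ℕ → α → Prop) (len : α → ℕ) (L : List ℕ) (k : ℕ) :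
    Option ℕ :=
  (request R (L.take k)).map len

theorem primrecRel_allotted (hR : PrimrecRel R) (hlen : Primrec len) :
    PrimrecRel fun (L : List ℕ) (σ : List Bool) => Allotted (requestLen R len L) L.length σ := by
  have hreq : Primrec₂ (requestLen R len) :=
    Primrec.option_map ((primrec_request hR).comp (Primrec.list_take.comp Primrec.snd Primrec.fst))
      (hlen.comp Primrec.snd)
  have hstep : Primrec₂ fun (L : List ℕ) (q : ℕ × (ℕ × ℕ)) =>
      ((requestLen R len L q.1).casesOn q.2 fun l => (q.2.1 * 2 ^ l + 2 ^ q.2.2, q.2.2 + l) :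
        ℕ × ℕ) := by
    refine Primrec.option_casesOn (hreq.comp Primrec.fst (Primrec.fst.comp Primrec.snd))
      (Primrec.snd.comp Primrec.snd) ?_
    have hx : Primrec fun p : (List ℕ × (ℕ × (ℕ × ℕ))) × ℕ => p.1.2.2.1 :=
      Primrec.fst.comp (Primrec.snd.comp (Primrec.snd.comp Primrec.fst))
    have hm : Primrec fun p : (List ℕ × (ℕ × (ℕ × ℕ))) × ℕ => p.1.2.2.2 :=
      Primrec.snd.comp (Primrec.snd.comp (Primrec.snd.comp Primrec.fst))
    exact Primrec.pair (Primrec.nat_add.comp (Primrec.nat_mul.comp hx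
      (primrec_pow.comp (Primrec.const 2) Primrec.snd)) (primrec_pow.comp (Primrec.const 2) hm))
      (Primrec.nat_add.comp hm Primrec.snd)
  have hsum : Primrec fun L : List ℕ => dyadicSum (requestLen R len L) L.length := by
    refine (Primrec.nat_rec' Primrec.list_length (Primrec.const (0, 0)) hstep).of_eq fun L => ?_
    induction L.length with
    | zero => rfl
    | succ k ih =>
      rw [dyadicSum, ← ih]
      dsimp only
      cases requestLen R len L k <;> rfl
  have hx : Primrec fun p : List ℕ × List Bool =>
      (dyadicSum (requestLen R len p.1) p.1.length).1 := Primrec.fst.comp (hsum.comp Primrec.fst)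
  have hm : Primrec fun p : List ℕ × List Bool =>
      (dyadicSum (requestLen R len p.1) p.1.length).2 := Primrec.snd.comp (hsum.comp Primrec.fst)
  have hl : Primrec fun p : List ℕ × List Bool => p.2.length :=
    Primrec.list_length.comp Primrec.snd
  have hv : Primrec fun p : List ℕ × List Bool => val p.2 := primrec_val.comp Primrec.snd
  have h2 {f : List ℕ × List Bool → ℕ} (hf : Primrec f) : Primrec fun p => 2 ^ f p :=
    primrec_pow.comp (Primrec.const 2) hf
  refine PrimrecPred.and (Primrec.eq.comp (hreq.comp Primrec.fst
    (Primrec.list_length.comp Primrec.fst)) (Primrec.option_some.comp (Primrec.pred.comp hl))) ?_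
  refine PrimrecPred.and (Primrec.nat_lt.comp (Primrec.const 0) hl) ?_
  refine PrimrecPred.and (Primrec.nat_le.comp (Primrec.nat_mul.comp hx (h2 hl))
    (Primrec.nat_mul.comp hv (h2 hm))) ?_
  exact Primrec.nat_le.comp (Primrec.nat_mul.comp (Primrec.succ.comp hv) (h2 hm))
    (Primrec.nat_add.comp (Primrec.nat_mul.comp hx (h2 hl)) (h2 (Primrec.succ.comp hm)))

theorem allotted_seg {t : ℕ} {σ : List Bool} :
    Allotted (requestLen R len (seg O t)) (seg O t).length σ ↔
      Allotted (fun k => (request R (seg O k)).map len) t σ := by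
  rw [length_seg]
  exact Allotted.congr (fun i hi => by rw [requestLen, take_seg_of_le _ hi]) σ

theorem sum_weight_le_one {P : α → Prop} (hP : ∀ a, P a ↔ ∃ s, R (seg O s) a)
    (hsum : ∑' a : {a // P a}, (2⁻¹ : ENNReal) ^ len a ≤ 1) (k : ℕ) :
    ∑ i ∈ Finset.range k, weight ((request R (seg O i)).map len) ≤ 1 := by
  have hw (o : Option ℕ) : ENNReal.ofReal (weight o) = o.elim 0 fun l => (2⁻¹ : ENNReal) ^ l := by
    cases o with
    | none => simp [weight]
    | some l =>
      rw [weight_some, one_div, ← inv_pow, ENNReal.ofReal_pow (by norm_num),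
        ENNReal.ofReal_inv_of_pos (by norm_num)]
      simp
  rw [← ENNReal.ofReal_le_one, ENNReal.ofReal_sum_of_nonneg fun i _ => weight_nonneg _]
  refine le_trans (le_trans (ENNReal.sum_le_tsum _) ?_) hsum
  set S : Set ℕ := {i | ((request R (seg O i)).isSome : Prop)}
  rw [← tsum_subtype_eq_of_support_subset (s := S)]
  · have hmem (i : S) : P ((request R (seg O i)).get i.2) := by
      have := request_eq_some.1 (Option.some_get i.2).symm
      rw [length_seg, take_seg_of_le _ (Nat.unpair_left_le _)] at this
      exact (hP _).2 ⟨_, this.2.1⟩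
    have hinj : Function.Injective
        fun i : S => (⟨(request R (seg O i)).get i.2, hmem i⟩ : {a // P a}) := by
      intro i j hij
      have hij := congrArg Subtype.val hij
      refine Subtype.ext (request_inj (Option.some_get i.2).symm ?_)
      simp only at hij
      rw [hij, Option.some_get]
    refine le_trans (le_of_eq (tsum_congr fun i => ?_))
      (ENNReal.tsum_comp_le_tsum_of_injective hinj fun a => (2⁻¹ : ENNReal) ^ len a)
    rw [hw]
    conv_lhs => rw [← Option.some_get i.2]
    rfl
  · intro i hi
    rw [Function.mem_support, hw] at hi
    by_contra h
    simp only [S, Set.mem_ofPred_eq, Option.not_isSome_iff_eq_none] at h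
    simp [h] at hi

/-- The Kraft–Chaitin theorem. -/
theorem REIn.kraft_chaitin {u : OracleCode} (hu : UniversalPFM u) {P : α → Prop} (h : REIn O P)
    (hlen : Primrec len) {out : α → List Bool} (hout : Primrec out)
    (hsum : ∑' a : {a // P a}, (2⁻¹ : ENNReal) ^ len a ≤ 1) :
    ∃ d, ∀ a, P a → ∃ σ, out a ∈ LMD.evalStr u O σ ∧ σ.length ≤ len a + d := by
  obtain ⟨R, hR, hP⟩ := h
  obtain ⟨c, hc⟩ := OracleCode.exists_search
    (R := fun L x => ∃ σ ∈ (Encodable.decode (α := List Bool) x).toList,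
      Allotted (requestLen R len L) L.length σ)
    (F := fun L _ => Encodable.encode (((request R L).map out).getD []))
    ((primrecRel_allotted hR hlen).swap.exists_mem_list.comp
      (Primrec.optionToList.comp (Primrec.decode.comp Primrec.snd)) Primrec.fst)
    (Primrec.encode.comp (Primrec.option_getD.comp (Primrec.option_map
      ((primrec_request hR).comp Primrec.fst) (hout.comp Primrec.snd)) (Primrec.const [])))
  have hev {O : ℕ → ℕ} {σ τ : List Bool} : τ ∈ LMD.evalStr c O σ ↔
      ∃ t, Allotted (fun k => (request R (seg O k)).map len) t σ ∧
        τ = ((request R (seg O t)).map out).getD [] := by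
    simp only [mem_evalStr, hc, Encodable.encodek, Option.toList_some, List.mem_singleton,
      exists_eq_left, allotted_seg]
    constructor
    · rintro ⟨m, ⟨s, hs, -, rfl⟩, hm⟩
      rw [Encodable.encodek] at hm
      exact ⟨s, hs, (Option.some.inj hm).symm⟩
    · rintro ⟨t, ht, rfl⟩
      refine ⟨_, ⟨t, ht, fun s hs h => hs.ne (h.eq_of_prefix ht List.prefix_rfl).1, rfl⟩,
        Encodable.encodek _⟩
  have hpf : PrefixFreeMachine c := by
    intro O σ₁ σ₂ hpre h₁ h₂
    obtain ⟨τ₁, h₁⟩ := Part.dom_iff_mem.1 h₁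
    obtain ⟨τ₂, h₂⟩ := Part.dom_iff_mem.1 h₂
    obtain ⟨t₁, h₁, -⟩ := hev.1 h₁
    obtain ⟨t₂, h₂, -⟩ := hev.1 h₂
    exact (h₁.eq_of_prefix h₂ hpre).2
  obtain ⟨d, hd⟩ := hu.2 c hpf
  refine ⟨d + 1, fun a ha => ?_⟩
  obtain ⟨t, ht⟩ := exists_request ((hP a).1 ha)
  obtain ⟨σ, hσ, hall⟩ := exists_allotted
    (e := fun k => (request R (seg O k)).map len) (k := t) (l := len a) (by simp [ht])
    (sum_weight_le_one hP hsum _)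
  obtain ⟨σ', hσ', hle⟩ := hd O σ (out a) (hev.2 ⟨t, hall, by simp [ht]⟩)
  exact ⟨σ', hσ', by omega⟩

end Requests

theorem mem_cyl {W : Set (List Bool)} {X : ℕ → Bool} : X ∈ Cyl W ↔ ∃ s, seg X s ∈ W := by
  have key (σ : List Bool) : (∀ i : Fin σ.length, X i = σ.get i) ↔ seg X σ.length = σ := by
    constructor
    · intro h
      refine List.ext_getElem (by simp) fun i h1 h2 => ?_
      simpa [seg] using h ⟨i, h2⟩
    · intro h i
      have : σ.get i = (seg X σ.length)[i.1]'(by simp) := by simp [h]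
      rw [this]
      simp [seg]
  constructor
  · rintro ⟨σ, hσ, h⟩
    exact ⟨σ.length, by rwa [(key σ).1 h]⟩
  · rintro ⟨s, hs⟩
    exact ⟨_, hs, (key _).2 (by simp)⟩

theorem mem_cyl_singleton {σ : List Bool} {X : ℕ → Bool} :
    X ∈ Cyl {σ} ↔ seg X σ.length = σ := by
  rw [mem_cyl]
  exact ⟨fun ⟨s, hs⟩ => by rw [← Set.mem_singleton_iff.1 hs, length_seg], fun h => ⟨_, h⟩⟩

theorem cyl_eq_biUnion (W : Set (List Bool)) : Cyl W = ⋃ σ ∈ W, Cyl {σ} := by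
  ext X
  simp only [Set.mem_iUnion, exists_prop, mem_cyl_singleton]
  rw [mem_cyl]
  exact ⟨fun ⟨s, hs⟩ => ⟨_, hs, by simp⟩, fun ⟨σ, hσ, h⟩ => ⟨σ.length, by rwa [h]⟩⟩

theorem measurableSet_seg_eq (σ : List Bool) (s : ℕ) :
    MeasurableSet {X : ℕ → Bool | seg X s = σ} := by
  induction s generalizing σ with
  | zero => simp
  | succ s ih =>
    have : {X : ℕ → Bool | seg X (s + 1) = σ} =
        {X | seg X s = σ.dropLast} ∩ {X | σ = σ.dropLast ++ [X s]} := by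
      ext X
      simp only [seg_succ, Set.mem_ofPred_eq, Set.mem_inter_iff]
      constructor
      · rintro rfl
        simp
      · rintro ⟨h, h'⟩
        rw [h]
        exact h'.symm
    rw [this]
    refine (ih _).inter ?_
    exact (measurable_pi_apply (X := fun _ : ℕ => Bool) s)
      (MeasurableSet.of_discrete (s := {b | σ = σ.dropLast ++ [b]}))

theorem measurableSet_cyl (W : Set (List Bool)) : MeasurableSet (Cyl W) := by
  rw [cyl_eq_biUnion]
  refine MeasurableSet.biUnion (Set.to_countable W) fun σ _ => ?_
  have : Cyl {σ} = {X | seg X σ.length = σ} := Set.ext fun X => mem_cyl_singleton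
  rw [this]
  exact measurableSet_seg_eq _ _

theorem cyl_mono {V W : Set (List Bool)} (h : V ⊆ W) : Cyl V ⊆ Cyl W :=
  fun _ ⟨σ, hσ, hX⟩ => ⟨σ, h hσ, hX⟩

theorem cyl_nil : Cyl {[]} = Set.univ :=
  Set.eq_univ_of_forall fun _ => mem_cyl_singleton.2 rfl

/-- Two finite measures on Cantor space that agree on the basic open sets are equal. -/
theorem ext_of_cyl {μ ν : Measure (ℕ → Bool)} [IsFiniteMeasure μ]
    (h : ∀ σ : List Bool, μ (Cyl {σ}) = ν (Cyl {σ})) : μ = ν := by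
  let C : Set (Set (ℕ → Bool)) := insert ∅ (Set.range fun σ : List Bool => Cyl {σ})
  refine ext_of_generate_finite C ?_ ?_ ?_ (by rw [← cyl_nil]; exact h [])
  · apply le_antisymm
    · rw [MeasurableSpace.pi, iSup_le_iff]
      rintro n _ ⟨t, -, rfl⟩
      have : (fun X : ℕ → Bool => X n) ⁻¹' t =
          ⋃ σ ∈ {σ : List Bool | ∃ b ∈ t, σ[n]? = some b}, Cyl {σ} := by
        rw [← cyl_eq_biUnion]
        ext X
        rw [mem_cyl]
        constructor
        · intro hX
          exact ⟨n + 1, X n, hX, by rw [getElem?_seg, if_pos n.lt_succ_self]⟩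
        · rintro ⟨s, b, hb, hs⟩
          rw [getElem?_seg] at hs
          split_ifs at hs
          rw [Set.mem_preimage, Option.some.inj hs]
          exact hb
      rw [this]
      exact MeasurableSet.biUnion (Set.to_countable _) fun σ _ =>
        MeasurableSpace.measurableSet_generateFrom (Or.inr ⟨σ, rfl⟩)
    · refine MeasurableSpace.generateFrom_le ?_
      rintro _ (rfl | ⟨σ, rfl⟩)
      · exact MeasurableSet.empty
      · exact measurableSet_cyl _
  · rintro _ (rfl | ⟨σ, rfl⟩) _ (rfl | ⟨τ, rfl⟩) hne
    any_goals simp at hne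
    obtain ⟨X, hX, hX'⟩ := hne
    simp only [mem_cyl_singleton] at hX hX'
    right
    rcases le_total σ.length τ.length with hl | hl
    · refine ⟨τ, Set.ext fun Y => ?_⟩
      simp only [Set.mem_inter_iff, mem_cyl_singleton]
      refine ⟨fun hY => ⟨?_, hY⟩, fun hY => hY.2⟩
      rw [← take_seg_of_le _ hl, hY, ← hX', take_seg_of_le _ hl, hX]
    · refine ⟨σ, Set.ext fun Y => ?_⟩
      simp only [Set.mem_inter_iff, mem_cyl_singleton]
      refine ⟨fun hY => ⟨hY, ?_⟩, fun hY => hY.1⟩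
      rw [← take_seg_of_le _ hl, hY, ← hX, take_seg_of_le _ hl, hX']
  · rintro _ (rfl | ⟨σ, rfl⟩)
    · simp
    · exact h σ

/-- The binary expansion of a real number. -/
noncomputable def binary (x : ℝ) (n : ℕ) : Bool := decide (⌊x * 2 ^ (n + 1)⌋₊ % 2 = 1)

theorem measurable_binary : Measurable binary := by
  refine measurable_pi_lambda _ fun n => ?_
  have h1 : Measurable fun x : ℝ => ⌊x * 2 ^ (n + 1)⌋₊ :=
    Nat.measurable_floor.comp (measurable_id.mul_const _)
  exact (Measurable.of_discrete (f := fun k : ℕ => decide (k % 2 = 1))).comp h1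

theorem val_seg_binary {x : ℝ} (hx : x ∈ Set.Ico (0 : ℝ) 1) (n : ℕ) :
    val (seg (binary x) n) = ⌊x * 2 ^ n⌋₊ := by
  induction n with
  | zero => simpa using (Nat.floor_eq_zero.2 hx.2).symm
  | succ n ih =>
    rw [seg_succ, val_concat, ih]
    have h : ⌊x * 2 ^ n⌋₊ = ⌊x * 2 ^ (n + 1)⌋₊ / 2 := by
      rw [← Nat.floor_div_ofNat, pow_succ, ← mul_assoc]
      simp
    rw [h, binary]
    by_cases h2 : ⌊x * 2 ^ (n + 1)⌋₊ % 2 = 1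
    · simp only [h2, decide_true, Bool.toNat_true]; omega
    · simp only [h2, decide_false, Bool.toNat_false]; omega

theorem val_injective {σ τ : List Bool} (hl : σ.length = τ.length) (h : val σ = val τ) : σ = τ := by
  induction σ using List.reverseRecOn generalizing τ with
  | nil => exact (List.length_eq_zero_iff.1 hl.symm).symm
  | append_singleton σ b ih =>
    induction τ using List.reverseRecOn with
    | nil => simp at hl
    | append_singleton τ c _ =>
      simp only [List.length_append, List.length_singleton, Nat.add_right_cancel_iff] at hl
      rw [val_concat, val_concat] at h
      have hb := b.toNat_lt
      have hc := c.toNat_lt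
      have hbc : b.toNat = c.toNat := by omega
      rw [ih hl (by omega), show b = c by revert hbc; cases b <;> cases c <;> simp]

theorem mu_eq : mu = Measure.map binary (volume.restrict (Set.Ico (0 : ℝ) 1)) := rfl

instance : IsProbabilityMeasure mu := by
  have : IsProbabilityMeasure (volume.restrict (Set.Ico (0 : ℝ) 1)) := ⟨by simp⟩
  rw [mu_eq]
  exact Measure.isProbabilityMeasure_map measurable_binary.aemeasurable

theorem mu_cyl_singleton (σ : List Bool) : mu (Cyl {σ}) = 2⁻¹ ^ σ.length := by
  rw [mu_eq, Measure.map_apply measurable_binary (measurableSet_cyl _),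
    Measure.restrict_apply (measurable_binary (measurableSet_cyl _))]
  have hp : (0 : ℝ) < 2 ^ σ.length := by positivity
  have : binary ⁻¹' Cyl {σ} ∩ Set.Ico 0 1 = Set.Ico (lo σ) (lo σ + 1 / 2 ^ σ.length) := by
    ext x
    have hiff (hx : x ∈ Set.Ico (0 : ℝ) 1) : binary x ∈ Cyl {σ} ↔ ⌊x * 2 ^ σ.length⌋₊ = val σ := by
      rw [mem_cyl_singleton, ← val_seg_binary hx]
      exact ⟨fun h => by rw [h], fun h => val_injective (by simp) h⟩
    have hfl (hx : 0 ≤ x) : ⌊x * 2 ^ σ.length⌋₊ = val σ ↔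
        x ∈ Set.Ico (lo σ) (lo σ + 1 / 2 ^ σ.length) := by
      rw [Nat.floor_eq_iff (by positivity), Set.mem_Ico, lo, ← add_div, div_le_iff₀ hp,
        lt_div_iff₀ hp]
    constructor
    · rintro ⟨h, hx⟩
      exact (hfl hx.1).1 ((hiff hx).1 h)
    · intro h
      have hx0 : 0 ≤ x := (lo_nonneg σ).trans h.1
      have hx1 : x < 1 := h.2.trans_le (by
        rw [lo, ← add_div, div_le_one hp]
        exact_mod_cast val_lt σ)
      exact ⟨(hiff ⟨hx0, hx1⟩).2 ((hfl hx0).2 h), hx0, hx1⟩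
  rw [this, Real.volume_Ico, add_sub_cancel_left, one_div, ← inv_pow,
    ENNReal.ofReal_pow (by norm_num), ENNReal.ofReal_inv_of_pos (by norm_num)]
  simp

open scoped ENNReal

theorem two_inv_pow_ne_zero (n : ℕ) : (2⁻¹ : ℝ≥0∞) ^ n ≠ 0 := pow_ne_zero _ (by simp)

/-- A set of strings is prefix-free. -/
def PrefixFree (D : Set (List Bool)) : Prop := ∀ σ ∈ D, ∀ τ ∈ D, σ <+: τ → σ = τ

theorem seg_prefix_seg {X : ℕ → Bool} {s t : ℕ} (h : s ≤ t) : seg X s <+: seg X t := by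
  rw [← take_seg_of_le X h]; exact List.take_prefix _ _

theorem PrefixFree.eq_of_seg {D : Set (List Bool)} (hD : PrefixFree D) {X : ℕ → Bool} {s t : ℕ}
    (hs : seg X s ∈ D) (ht : seg X t ∈ D) : s = t := by
  rcases le_total s t with h | h
  · simpa using congrArg List.length (hD _ hs _ ht (seg_prefix_seg h))
  · simpa using (congrArg List.length (hD _ ht _ hs (seg_prefix_seg h))).symm

theorem PrefixFree.mu_cyl {D : Set (List Bool)} (hD : PrefixFree D) :
    mu (Cyl D) = ∑' σ : D, 2⁻¹ ^ σ.1.length := by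
  rw [cyl_eq_biUnion, measure_biUnion (Set.to_countable D) ?_ fun σ _ => measurableSet_cyl _]
  · simp_rw [mu_cyl_singleton]
  · intro σ hσ τ hτ hne
    refine Set.disjoint_left.2 fun X hX hX' => hne ?_
    rw [mem_cyl_singleton] at hX hX'
    rw [← hX, ← hX', hD.eq_of_seg (X := X) (s := σ.length) (t := τ.length)
      (by rwa [hX]) (by rwa [hX'])]

theorem PrefixFree.tsum_le_one {D : Set (List Bool)} (hD : PrefixFree D) :
    ∑' σ : D, (2⁻¹ : ℝ≥0∞) ^ σ.1.length ≤ 1 := by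
  rw [← hD.mu_cyl]; exact prob_le_one

theorem mu_seg_mem {l : List (List Bool)} (hl : l.Nodup) {s : ℕ} (h : ∀ σ ∈ l, σ.length = s) :
    mu {X | seg X s ∈ l} = l.length * 2⁻¹ ^ s := by
  have hset : {X : ℕ → Bool | seg X s ∈ l} = Cyl {σ | σ ∈ l} := by
    ext X
    rw [mem_cyl]
    refine ⟨fun hX => ⟨s, hX⟩, fun ⟨t, ht⟩ => ?_⟩
    have : t = s := by simpa using h _ ht
    exact this ▸ ht
  have hpf : PrefixFree {σ | σ ∈ l} := fun σ hσ τ hτ hp =>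
    hp.eq_of_length ((h σ hσ).trans (h τ hτ).symm)
  have hS : {σ | σ ∈ l} = (l.toFinset : Set (List Bool)) := by ext; simp
  rw [hset, hpf.mu_cyl, hS, Finset.tsum_subtype' l.toFinset fun σ => (2⁻¹ : ℝ≥0∞) ^ σ.length,
    Finset.sum_congr rfl (g := fun _ => 2⁻¹ ^ s) fun σ hσ => by rw [h σ (List.mem_toFinset.1 hσ)],
    Finset.sum_const, List.toFinset_card_of_nodup hl, nsmul_eq_mul]

/-- The sequence obtained by putting the string `σ` in front of `X`. -/
def prepend (σ : List Bool) (X : ℕ → Bool) (n : ℕ) : Bool := σ[n]?.getD (X (n - σ.length))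

theorem seg_prepend (σ : List Bool) (X : ℕ → Bool) (s : ℕ) :
    seg (prepend σ X) s = σ.take s ++ seg X (s - σ.length) := by
  refine List.ext_getElem? fun i => ?_
  rw [getElem?_seg, List.getElem?_append, List.length_take, List.getElem?_take, getElem?_seg,
    prepend]
  by_cases h1 : i < s <;> by_cases h2 : i < σ.length
  · simp [h1, h2]
  · have h3 : ¬ i < min s σ.length := by omega
    have h4 : i - min s σ.length < s - σ.length := by omega
    have h5 : i - min s σ.length = i - σ.length := by omega
    rw [if_pos h1, if_neg h3, if_pos h4, h5, List.getElem?_eq_none (by omega)]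
    rfl
  · have h3 : ¬ i < min s σ.length := by omega
    have h4 : ¬ i - min s σ.length < s - σ.length := by omega
    rw [if_neg h1, if_neg h3, if_neg h4]
  · have h3 : ¬ i < min s σ.length := by omega
    have h4 : ¬ i - min s σ.length < s - σ.length := by omega
    rw [if_neg h1, if_neg h3, if_neg h4]

theorem seg_prepend_add (σ : List Bool) (X : ℕ → Bool) (s : ℕ) :
    seg (prepend σ X) (σ.length + s) = σ ++ seg X s := by
  rw [seg_prepend, List.take_of_length_le (by omega), Nat.add_sub_cancel_left]

theorem measurable_prepend (σ : List Bool) : Measurable (prepend σ) := by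
  refine measurable_pi_lambda _ fun n => ?_
  unfold prepend
  cases σ[n]? with
  | none => exact measurable_pi_apply _
  | some b => exact measurable_const

theorem prepend_preimage_cyl (σ τ : List Bool) :
    prepend σ ⁻¹' Cyl {σ ++ τ} = Cyl {τ} := by
  ext X
  rw [Set.mem_preimage, mem_cyl_singleton, mem_cyl_singleton, List.length_append, seg_prepend_add,
    List.append_right_inj]

theorem mu_inter_cyl_singleton {E : Set (ℕ → Bool)} (hE : MeasurableSet E) (σ : List Bool) :
    mu (E ∩ Cyl {σ}) = 2⁻¹ ^ σ.length * mu (prepend σ ⁻¹' E) := by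
  have key : mu.restrict (Cyl {σ}) = ((2⁻¹ : ℝ≥0∞) ^ σ.length) • mu.map (prepend σ) := by
    refine ext_of_cyl fun τ => ?_
    rw [Measure.restrict_apply (measurableSet_cyl _), Measure.smul_apply,
      Measure.map_apply (measurable_prepend σ) (measurableSet_cyl _), smul_eq_mul]
    rcases le_total τ.length σ.length with hl | hl
    · by_cases hp : σ.take τ.length = τ
      · have h1 : Cyl {τ} ∩ Cyl {σ} = Cyl {σ} := by
          refine Set.inter_eq_right.2 fun X hX => ?_
          rw [mem_cyl_singleton] at hX ⊢
          rw [← take_seg_of_le X hl, hX, hp]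
        have h2 : prepend σ ⁻¹' Cyl {τ} = Set.univ := by
          refine Set.eq_univ_of_forall fun X => ?_
          rw [Set.mem_preimage, mem_cyl_singleton, seg_prepend, hp, Nat.sub_eq_zero_of_le hl]
          simp
        rw [h1, h2, mu_cyl_singleton, measure_univ, mul_one]
      · have h1 : Cyl {τ} ∩ Cyl {σ} = ∅ := by
          refine Set.eq_empty_of_forall_notMem fun X ⟨hX, hX'⟩ => hp ?_
          rw [mem_cyl_singleton] at hX hX'
          rw [← hX', take_seg_of_le X hl, hX]
        have h2 : prepend σ ⁻¹' Cyl {τ} = ∅ := by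
          refine Set.eq_empty_of_forall_notMem fun X hX => hp ?_
          rw [Set.mem_preimage, mem_cyl_singleton, seg_prepend, Nat.sub_eq_zero_of_le hl] at hX
          simpa using hX
        rw [h1, h2, measure_empty, mul_zero]
    · by_cases hp : σ <+: τ
      · obtain ⟨ρ, rfl⟩ := hp
        have h1 : Cyl {σ ++ ρ} ∩ Cyl {σ} = Cyl {σ ++ ρ} := by
          refine Set.inter_eq_left.2 fun X hX => ?_
          rw [mem_cyl_singleton] at hX ⊢
          rw [← take_seg_of_le X hl, hX, List.take_left]
        rw [h1, prepend_preimage_cyl, mu_cyl_singleton, mu_cyl_singleton, List.length_append,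
          pow_add]
      · have h1 : Cyl {τ} ∩ Cyl {σ} = ∅ := by
          refine Set.eq_empty_of_forall_notMem fun X ⟨hX, hX'⟩ => hp ?_
          rw [mem_cyl_singleton] at hX hX'
          rw [← hX, ← hX']
          exact seg_prefix_seg hl
        have h2 : prepend σ ⁻¹' Cyl {τ} = ∅ := by
          refine Set.eq_empty_of_forall_notMem fun X hX => hp ?_
          rw [Set.mem_preimage, mem_cyl_singleton, seg_prepend, List.take_of_length_le hl] at hX
          exact ⟨_, hX⟩
        rw [h1, h2, measure_empty, mul_zero]
  have := congrArg (fun ν => ν E) key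
  simpa [Measure.restrict_apply hE, Measure.map_apply (measurable_prepend σ) hE] using this

/-- The fair coin. -/
noncomputable def coin : Measure Bool := (2⁻¹ : ℝ≥0∞) • (Measure.dirac true + Measure.dirac false)

theorem coin_singleton (b : Bool) : coin {b} = 2⁻¹ := by
  cases b <;> simp [coin]

instance : IsProbabilityMeasure coin := ⟨by
  simp only [coin, Measure.smul_apply, Measure.add_apply, measure_univ, smul_eq_mul]
  rw [one_add_one_eq_two, ENNReal.inv_mul_cancel (by simp) (by simp)]⟩

theorem mu_eq_infinitePi : mu = Measure.infinitePi fun _ : ℕ => coin := by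
  refine ext_of_cyl fun σ => ?_
  have : Cyl {σ} = Set.pi (Finset.range σ.length) fun i => {σ.getD i false} := by
    ext X
    simp only [Set.mem_pi, Finset.coe_range, Set.mem_Iio, Set.mem_singleton_iff]
    constructor
    · rintro ⟨_, rfl, h⟩ i hi
      simpa [hi] using h ⟨i, hi⟩
    · intro h
      exact ⟨σ, rfl, fun i => by simpa using h i i.2⟩
  rw [mu_cyl_singleton, this, Measure.infinitePi_pi _ fun i _ => MeasurableSet.singleton _]
  simp [coin_singleton]

theorem mu_forall_mem_true (G : Finset ℕ) : mu {X | ∀ i ∈ G, X i = true} = 2⁻¹ ^ G.card := by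
  have : {X : ℕ → Bool | ∀ i ∈ G, X i = true} = Set.pi G fun _ => {true} := by
    ext X; simp [Set.mem_pi]
  rw [mu_eq_infinitePi, this, Measure.infinitePi_pi _ fun i _ => MeasurableSet.singleton _]
  simp [coin_singleton]

/-- The set of sequences whose `j`-th column starts with `n` ones. -/
def Block (n j : ℕ) : Set (ℕ → Bool) := {X | ∀ i < n, X (Nat.pair j i) = true}

theorem mu_biInter_block (n : ℕ → ℕ) (F : Finset ℕ) :
    mu (⋂ j ∈ F, Block (n j) j) = ∏ j ∈ F, 2⁻¹ ^ n j := by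
  have : (⋂ j ∈ F, Block (n j) j) =
      {X : ℕ → Bool | ∀ k ∈ (F.sigma fun j => Finset.range (n j)).image
      fun p : (_ : ℕ) × ℕ => Nat.pair p.1 p.2, X k = true} := by
    ext X
    simp only [Set.mem_iInter, Block, Set.mem_ofPred_eq, Finset.mem_image, Finset.mem_sigma,
      Finset.mem_range]
    constructor
    · rintro h _ ⟨p, ⟨h1, h2⟩, rfl⟩
      exact h _ h1 _ h2
    · intro h j hj i hi
      exact h _ ⟨⟨j, i⟩, ⟨hj, hi⟩, rfl⟩
  rw [this, mu_forall_mem_true, Finset.card_image_of_injective, Finset.card_sigma]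
  · simp [Finset.prod_pow_eq_pow_sum]
  · rintro ⟨a, b⟩ ⟨c, d⟩ h
    obtain ⟨rfl, rfl⟩ := Nat.pair_eq_pair.1 h
    rfl

theorem mu_block (n j : ℕ) : mu (Block n j) = 2⁻¹ ^ n := by
  simpa using mu_biInter_block (fun _ => n) {j}

theorem measurableSet_block (n j : ℕ) : MeasurableSet (Block n j) := by
  have : Block n j = ⋂ i ∈ Set.Iio n, (fun X : ℕ → Bool => X (Nat.pair j i)) ⁻¹' {true} := by
    ext X; simp [Block]
  rw [this]
  exact MeasurableSet.biInter (Set.to_countable _) fun i _ =>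
    (measurable_pi_apply (X := fun _ : ℕ => Bool) _) (MeasurableSet.singleton _)

theorem mu_biInter_compl_block (n : ℕ → ℕ) (F : Finset ℕ) :
    mu (⋂ j ∈ F, (Block (n j) j)ᶜ) = ∏ j ∈ F, (1 - 2⁻¹ ^ n j) := by
  have hind : ProbabilityTheory.iIndepSet (fun j => Block (n j) j) mu := by
    rw [ProbabilityTheory.iIndepSet_iff_meas_biInter fun j => measurableSet_block _ _]
    intro F
    rw [mu_biInter_block]
    simp_rw [mu_block]
  rw [ProbabilityTheory.iIndep.meas_biInter hind fun j _ =>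
    (MeasurableSpace.measurableSet_generateFrom (Set.mem_singleton _)).compl]
  refine Finset.prod_congr rfl fun j _ => ?_
  rw [prob_compl_eq_one_sub (measurableSet_block _ _), mu_block]

section NormalForm

variable {O : ℕ → ℕ} {ι : Type*} [Primcodable ι] {W : ι → Set (List Bool)}

/-- A uniformly `Σ₁` sequence of open sets is generated by sets of strings that are closed under
extensions and for which the first `|σ|` values of the oracle decide membership of `σ`. -/
theorem REIn.exists_decidable (hW : REIn O fun p : ι × List Bool => p.2 ∈ W p.1) :
    ∃ Q : List ℕ → ι × List Bool → Prop, PrimrecRel Q ∧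
      (∀ n σ τ, σ <+: τ → Q (seg O σ.length) (n, σ) → Q (seg O τ.length) (n, τ)) ∧
      (∀ s n σ, σ.length ≤ s → (Q (seg O s) (n, σ) ↔ Q (seg O σ.length) (n, σ))) ∧
      ∀ n X, X ∈ Cyl (W n) ↔ ∃ s, Q (seg O s) (n, seg X s) := by
  obtain ⟨R, hR, hmono, hRW⟩ := hW.exists_mono
  have hS : PrimrecRel fun (k : ℕ) (q : List ℕ × (ι × List Bool)) =>
      R (q.1.take q.2.2.length) (q.2.1, q.2.2.take k) := by
    have hσ : Primrec fun x : ℕ × (List ℕ × (ι × List Bool)) => x.2.2.2 :=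
      Primrec.snd.comp (Primrec.snd.comp Primrec.snd)
    exact hR.comp (Primrec.list_take.comp (Primrec.list_length.comp hσ)
      (Primrec.fst.comp Primrec.snd)) (Primrec.pair
        (Primrec.fst.comp (Primrec.snd.comp Primrec.snd)) (Primrec.list_take.comp Primrec.fst hσ))
  have hQ : PrimrecPred fun q : List ℕ × (ι × List Bool) => ∃ k < q.2.2.length + 1,
      R (q.1.take q.2.2.length) (q.2.1, q.2.2.take k) :=
    primrecPred_exists_lt hS (Primrec.succ.comp
      (Primrec.list_length.comp (Primrec.snd.comp Primrec.snd)))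
  refine ⟨fun L p => ∃ k < p.2.length + 1, R (L.take p.2.length) (p.1, p.2.take k), hQ, ?_, ?_, ?_⟩
  · rintro n σ τ ⟨ρ, rfl⟩ ⟨k, hk, h⟩
    rw [take_seg_of_le _ le_rfl] at h
    have hk' : k < σ.length + 1 := hk
    refine ⟨k, by simp; omega, ?_⟩
    rw [take_seg_of_le _ le_rfl]
    dsimp only at hk h ⊢
    rw [List.take_append_of_le_length (by omega)]
    exact hmono _ _ _ (by simp) h
  · intro s n σ hs
    simp only [take_seg_of_le _ hs, take_seg_of_le _ le_rfl]
  · intro n X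
    rw [mem_cyl]
    constructor
    · rintro ⟨t, ht⟩
      obtain ⟨s, hs⟩ := (hRW (n, _)).1 ht
      refine ⟨max s t, t, by simp, ?_⟩
      simp only [length_seg]
      rw [take_seg_of_le _ (le_max_right _ _), take_seg_of_le _ le_rfl]
      exact hmono _ _ _ (le_max_left _ _) hs
    · rintro ⟨s, k, hk, h⟩
      simp only [length_seg] at hk h
      rw [take_seg_of_le _ le_rfl, take_seg_of_le _ (by omega)] at h
      exact ⟨k, (hRW (n, _)).2 ⟨s, h⟩⟩

theorem REIn.exists_prefixFree (hW : REIn O fun p : ι × List Bool => p.2 ∈ W p.1) :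
    ∃ D : ι → Set (List Bool), REIn O (fun p : ι × List Bool => p.2 ∈ D p.1) ∧
      (∀ n, PrefixFree (D n)) ∧ ∀ n, Cyl (D n) = Cyl (W n) := by
  classical
  obtain ⟨Q, hQ, hmono, hdec, hQW⟩ := hW.exists_decidable
  refine ⟨fun n => {σ | Q (seg O σ.length) (n, σ) ∧ ∀ k < σ.length, ¬ Q (seg O k) (n, σ.take k)},
    ?_, ?_, ?_⟩
  · have hσ : Primrec fun q : List ℕ × (ι × List Bool) => q.2.2 := Primrec.snd.comp Primrec.snd
    have hS : PrimrecRel fun (k : ℕ) (q : List ℕ × (ι × List Bool)) =>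
        ¬ Q q.1 (q.2.1, q.2.2.take k) :=
      PrimrecPred.not (hQ.comp (Primrec.fst.comp Primrec.snd) (Primrec.pair
        (Primrec.fst.comp (Primrec.snd.comp Primrec.snd))
        (Primrec.list_take.comp Primrec.fst (hσ.comp Primrec.snd))))
    have hT : PrimrecPred fun q : List ℕ × (ι × List Bool) => q.2.2.length ≤ q.1.length ∧
        Q q.1 q.2 ∧ ∀ k < q.2.2.length, ¬ Q q.1 (q.2.1, q.2.2.take k) :=
      (Primrec.nat_le.comp (Primrec.list_length.comp hσ)
        (Primrec.list_length.comp Primrec.fst)).and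
        (hQ.and (primrecPred_forall_lt hS (Primrec.list_length.comp hσ)))
    refine ⟨fun L p => p.2.length ≤ L.length ∧ Q L p ∧ ∀ k < p.2.length, ¬ Q L (p.1, p.2.take k),
      hT, fun ⟨n, σ⟩ => ?_⟩
    have key {s : ℕ} (hs : σ.length ≤ s) : (Q (seg O s) (n, σ) ∧ ∀ k < σ.length,
        ¬ Q (seg O s) (n, σ.take k)) ↔ Q (seg O σ.length) (n, σ) ∧ ∀ k < σ.length,
        ¬ Q (seg O k) (n, σ.take k) := by
      refine and_congr (hdec _ _ _ hs) (forall₂_congr fun k hk => not_congr ?_)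
      have hl : (σ.take k).length = k := by simp [hk.le]
      rw [hdec _ _ _ (hl.le.trans (hk.le.trans hs)), hl]
    constructor
    · intro h
      exact ⟨σ.length, by simp, (key le_rfl).2 h⟩
    · rintro ⟨s, hs, h⟩
      exact (key (by simpa using hs)).1 h
  · rintro n σ ⟨hσ, -⟩ τ ⟨-, hτ⟩ hp
    by_contra hne
    have hlt : σ.length < τ.length :=
      lt_of_le_of_ne hp.length_le fun h => hne (hp.eq_of_length h)
    refine hτ _ hlt ?_
    rwa [← List.prefix_iff_eq_take.1 hp]
  · intro n
    ext X
    rw [hQW, mem_cyl]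
    constructor
    · rintro ⟨s, hs, -⟩
      exact ⟨s, by simpa using hs⟩
    · intro h
      refine ⟨Nat.find h, by simpa using Nat.find_spec h, fun k hk => ?_⟩
      rw [length_seg] at hk
      rw [take_seg_of_le _ hk.le]
      exact Nat.find_min h hk

end NormalForm

section UniversalTest

variable {u : OracleCode} {O : ℕ → ℕ}

theorem mu_exists_eval_le (hu : UniversalPFM u) (T : List Bool → List Bool → Set (ℕ → Bool))
    (hT : ∀ ρ τ, τ ∈ evalStr u O ρ → mu (T ρ τ) ≤ 2⁻¹ ^ (ρ.length + 1)) :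
    mu {X | ∃ ρ τ, τ ∈ evalStr u O ρ ∧ X ∈ T ρ τ} ≤ 2⁻¹ := by
  set D : Set (List Bool) := {ρ | (evalStr u O ρ).Dom}
  have hD : PrefixFree D := fun σ hσ τ hτ h => hu.1 O σ τ h hσ hτ
  calc mu {X | ∃ ρ τ, τ ∈ evalStr u O ρ ∧ X ∈ T ρ τ}
      ≤ mu (⋃ ρ : D, T ρ.1 ((evalStr u O ρ.1).get ρ.2)) := by
        refine measure_mono ?_
        rintro X ⟨ρ, τ, hτ, hX⟩
        have hρ : ρ ∈ D := Part.dom_iff_mem.2 ⟨τ, hτ⟩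
        refine Set.mem_iUnion.2 ⟨⟨ρ, hρ⟩, ?_⟩
        rwa [Part.get_eq_of_mem hτ hρ]
    _ ≤ ∑' ρ : D, mu (T ρ.1 ((evalStr u O ρ.1).get ρ.2)) := measure_iUnion_le _
    _ ≤ ∑' ρ : D, 2⁻¹ ^ ρ.1.length * 2⁻¹ := by
        refine ENNReal.tsum_le_tsum fun ρ => ?_
        rw [← pow_succ]
        exact hT _ _ (Part.get_mem _)
    _ ≤ 1 * 2⁻¹ := by
        rw [ENNReal.tsum_mul_right]
        gcongr
        exact hD.tsum_le_one
    _ = 2⁻¹ := one_mul _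

/-- The strings that are compressed by at least one bit. -/
def compressed (u : OracleCode) (O : ℕ → ℕ) : Set (List Bool) :=
  {σ | ∃ ρ, σ ∈ evalStr u O ρ ∧ ρ.length + 1 ≤ σ.length}

theorem reIn_compressed : REIn O fun σ => σ ∈ compressed u O := by
  have h : REIn O fun p : List Bool × List Bool => p.1 ∈ evalStr u O p.2 ∧
      p.2.length + 1 ≤ p.1.length :=
    ((REIn.evalStr u).comp (Primrec.pair Primrec.snd Primrec.fst)).and
      (REIn.of_primrecPred (Primrec.nat_le.comp (Primrec.succ.comp
        (Primrec.list_length.comp Primrec.snd)) (Primrec.list_length.comp Primrec.fst)))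
  exact h.ex

theorem mu_compressed_le (hu : UniversalPFM u) : mu (Cyl (compressed u O)) ≤ 2⁻¹ := by
  refine le_trans (measure_mono ?_) (mu_exists_eval_le (O := O) hu
    (fun ρ τ => if ρ.length + 1 ≤ τ.length then Cyl {τ} else ∅) fun ρ τ _ => ?_)
  · intro X hX
    obtain ⟨s, ρ, hρ, hl⟩ := mem_cyl.1 hX
    refine ⟨ρ, _, hρ, ?_⟩
    rw [if_pos hl, mem_cyl_singleton, length_seg]
  · split_ifs with h
    · rw [mu_cyl_singleton]
      exact pow_le_pow_right_of_le_one' (by simp) h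
    · simp

theorem mlRandom_of_notMem_compressed (hu : UniversalPFM u) {B : Set ℕ} {X : ℕ → Bool}
    (hX : X ∉ Cyl (compressed u (chi B))) : MLRandom B X := by
  rintro U ⟨W, ⟨c, hc⟩, hUW, -, hU⟩ hXU
  have hW : REIn (chi B) fun p : ℕ × List Bool => p.2 ∈ W (2 * p.1 + 1) :=
    ((REIn.dom c).comp (Primrec₂.natPair.comp
      (Primrec.succ.comp (Primrec.nat_mul.comp (Primrec.const 2) Primrec.fst))
      (Primrec.encode.comp Primrec.snd))).of_iff fun p => (hc _ _).symm
  obtain ⟨D, hD, hpf, hDW⟩ := REIn.exists_prefixFree (W := fun n => W (2 * n + 1)) hW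
  have hmu (n : ℕ) : mu (Cyl (D n)) ≤ 2⁻¹ ^ (2 * n + 1) := by
    rw [hDW, ← hUW]; exact hU _
  have hsum : ∑' p : {p : ℕ × List Bool // p.2 ∈ D p.1}, (2⁻¹ : ℝ≥0∞) ^ (p.1.2.length - p.1.1) ≤
      1 := by
    rw [← (Equiv.subtypeProdEquivSigmaSubtype fun n σ => σ ∈ D n).symm.tsum_eq, ENNReal.tsum_sigma']
    calc ∑' (n : ℕ) (σ : D n), (2⁻¹ : ℝ≥0∞) ^ (σ.1.length - n)
        ≤ ∑' (n : ℕ) (σ : D n), 2 ^ n * 2⁻¹ ^ σ.1.length := by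
          refine ENNReal.tsum_le_tsum fun n => ENNReal.tsum_le_tsum fun σ => ?_
          calc (2⁻¹ : ℝ≥0∞) ^ (σ.1.length - n)
              = 2 ^ n * 2⁻¹ ^ (σ.1.length - n + n) := by
                rw [pow_add, mul_left_comm, ← mul_pow, ENNReal.mul_inv_cancel (by simp) (by simp),
                  one_pow, mul_one]
            _ ≤ 2 ^ n * 2⁻¹ ^ σ.1.length := by
                gcongr 2 ^ n * ?_
                exact pow_le_pow_right_of_le_one' (by simp) (by omega)
      _ ≤ ∑' n : ℕ, 2⁻¹ ^ (n + 1) := by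
          refine ENNReal.tsum_le_tsum fun n => ?_
          rw [ENNReal.tsum_mul_left, ← (hpf n).mu_cyl]
          calc (2 : ℝ≥0∞) ^ n * mu (Cyl (D n)) ≤ 2 ^ n * 2⁻¹ ^ (2 * n + 1) := by
                gcongr; exact hmu n
            _ = 2⁻¹ ^ (n + 1) := by
                rw [show 2 * n + 1 = n + (n + 1) by ring, pow_add, ← mul_assoc, ← mul_pow,
                  ENNReal.mul_inv_cancel (by simp) (by simp), one_pow, one_mul]
      _ = 1 := by simp_rw [pow_succ, ENNReal.tsum_mul_right, ENNReal.tsum_geometric,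
          ENNReal.one_sub_inv_two, inv_inv]; exact ENNReal.mul_inv_cancel (by simp) (by simp)
  have hlen : Primrec fun p : ℕ × List Bool => p.2.length - p.1 :=
    Primrec.nat_sub.comp (Primrec.list_length.comp Primrec.snd) Primrec.fst
  obtain ⟨d, hd⟩ := hD.kraft_chaitin hu
    (len := fun p => p.2.length - p.1) (out := fun p => p.2) hlen Primrec.snd hsum
  have hXD : X ∈ Cyl (D (d + 1)) := by
    rw [hDW, ← hUW]; exact Set.mem_iInter.1 hXU _
  obtain ⟨s, hs⟩ := mem_cyl.1 hXD
  obtain ⟨ρ, hρ, hl⟩ := hd (d + 1, seg X s) hs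
  refine hX (mem_cyl.2 ⟨s, ρ, hρ, ?_⟩)
  have h1 : mu (Cyl {seg X s}) ≤ 2⁻¹ ^ (2 * (d + 1) + 1) :=
    (measure_mono (cyl_mono (Set.singleton_subset_iff.2 hs))).trans (hmu _)
  rw [mu_cyl_singleton, length_seg] at h1
  have h2 : 2 * (d + 1) + 1 ≤ s := by
    by_contra h
    refine absurd h1 (not_le.2 ?_)
    rw [← ENNReal.inv_pow, ← ENNReal.inv_pow, ENNReal.inv_lt_inv]
    exact_mod_cast Nat.pow_lt_pow_right one_lt_two (not_le.1 h)
  simp only [length_seg] at hl ⊢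
  omega

end UniversalTest

section Kucera

variable {D : Set (List Bool)}

/-- The concatenations of `k` elements of `D`. -/
def catPow (D : Set (List Bool)) (k : ℕ) : Set (List Bool) :=
  {σ | ∃ L : List (List Bool), L.length = k ∧ (∀ w ∈ L, w ∈ D) ∧ L.flatten = σ}

theorem nil_mem_catPow_zero : [] ∈ catPow D 0 := ⟨[], by simp⟩

theorem append_mem_catPow {k : ℕ} {σ w : List Bool} (hσ : σ ∈ catPow D k) (hw : w ∈ D) :
    σ ++ w ∈ catPow D (k + 1) := by
  obtain ⟨L, hL, hLD, rfl⟩ := hσ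
  refine ⟨L ++ [w], by simp [hL], ?_, by simp⟩
  simp only [List.mem_append, List.mem_singleton]
  rintro x (hx | rfl)
  exacts [hLD x hx, hw]

theorem cyl_catPow_anti {j k : ℕ} (h : j ≤ k) : Cyl (catPow D k) ⊆ Cyl (catPow D j) := by
  intro X hX
  obtain ⟨s, L, hL, hLD, hs⟩ := mem_cyl.1 hX
  have hp : (L.take j).flatten ++ (L.drop j).flatten = seg X s := by
    rw [← List.flatten_append, List.take_append_drop, hs]
  have hl : (L.take j).flatten.length ≤ s := by
    simpa using (List.prefix_append _ _).length_le.trans_eq (congrArg List.length hp)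
  refine mem_cyl.2 ⟨(L.take j).flatten.length, L.take j, by simp [hL, h],
    fun w hw => hLD w (List.mem_of_mem_take hw), ?_⟩
  rw [← take_seg_of_le X hl, ← hp, List.take_left]

theorem mu_cyl_image_append (σ : List Bool) (T : Set (List Bool)) :
    mu (Cyl ((σ ++ ·) '' T)) = 2⁻¹ ^ σ.length * mu (Cyl T) := by
  have hsub : Cyl ((σ ++ ·) '' T) ⊆ Cyl {σ} := by
    intro X hX
    obtain ⟨s, τ, -, hτ⟩ := mem_cyl.1 hX
    dsimp only at hτ
    have hl : σ.length ≤ s := by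
      simpa using (List.prefix_append _ _).length_le.trans_eq (congrArg List.length hτ)
    rw [mem_cyl_singleton, ← take_seg_of_le X hl, ← hτ, List.take_left]
  have hpre : prepend σ ⁻¹' Cyl ((σ ++ ·) '' T) = Cyl T := by
    rw [cyl_eq_biUnion, cyl_eq_biUnion T, Set.biUnion_image, Set.preimage_iUnion₂]
    simp_rw [prepend_preimage_cyl]
  rw [← hpre, ← mu_inter_cyl_singleton (measurableSet_cyl _), Set.inter_eq_left.2 hsub]

theorem PrefixFree.mu_cyl_catPow_le (hD : PrefixFree D) (k : ℕ) :
    mu (Cyl (catPow D k)) ≤ mu (Cyl D) ^ k := by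
  induction k with
  | zero => simpa using prob_le_one
  | succ k ih =>
    have hsub : Cyl (catPow D (k + 1)) ⊆ ⋃ w : D, Cyl ((w.1 ++ ·) '' catPow D k) := by
      intro X hX
      obtain ⟨s, L, hL, hLD, hs⟩ := mem_cyl.1 hX
      cases L with
      | nil => simp at hL
      | cons w L =>
        refine Set.mem_iUnion.2 ⟨⟨w, hLD w (by simp)⟩, mem_cyl.2 ⟨s, L.flatten,
          ⟨L, by simpa using hL, fun x hx => hLD x (by simp [hx]), rfl⟩, by simpa using hs⟩⟩
    calc mu (Cyl (catPow D (k + 1)))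
        ≤ ∑' w : D, mu (Cyl ((w.1 ++ ·) '' catPow D k)) :=
          (measure_mono hsub).trans (measure_iUnion_le _)
      _ ≤ ∑' w : D, 2⁻¹ ^ w.1.length * mu (Cyl D) ^ k := by
          refine ENNReal.tsum_le_tsum fun w => ?_
          rw [mu_cyl_image_append]
          gcongr
      _ = mu (Cyl D) ^ (k + 1) := by rw [ENNReal.tsum_mul_right, ← hD.mu_cyl, pow_succ']

theorem reIn_catPow {O : ℕ → ℕ} (hD : REIn O fun σ => σ ∈ D) :
    REIn O fun p : ℕ × List Bool => p.2 ∈ catPow D p.1 := by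
  have h1 : REIn O fun q : (ℕ × List Bool) × List (List Bool) => q.2.length = q.1.1 :=
    REIn.of_primrecPred (Primrec.eq.comp (Primrec.list_length.comp Primrec.snd)
      (Primrec.fst.comp Primrec.fst))
  have h2 : REIn O fun q : (ℕ × List Bool) × List (List Bool) => q.2.flatten = q.1.2 :=
    REIn.of_primrecPred (Primrec.eq.comp (Primrec.list_flatten.comp Primrec.snd)
      (Primrec.snd.comp Primrec.fst))
  exact (h1.and ((hD.forall_mem.comp Primrec.snd).and h2)).ex

/-- An `A`-random sequence cannot be split into pieces from an `A`-c.e. prefix-free set whose open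
set has measure less than one. -/
theorem MLRandom.exists_notMem_catPow {A : Set ℕ} {X : ℕ → Bool} (hX : MLRandom A X)
    (hD : PrefixFree D) (hDA : REIn (chi A) fun σ => σ ∈ D) (hmu : mu (Cyl D) < 1) :
    ∃ k, X ∉ Cyl (catPow D k) := by
  obtain ⟨m, hm⟩ : ∃ m, mu (Cyl D) ^ m < 2⁻¹ :=
    ((ENNReal.tendsto_pow_atTop_nhds_zero_of_lt_one hmu).eventually
      (gt_mem_nhds (by simp : (0 : ℝ≥0∞) < 2⁻¹))).exists
  obtain ⟨c, hc⟩ := (reIn_catPow hDA).comp (f := fun p : ℕ × List Bool => (m * p.1, p.2))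
    (Primrec.pair (Primrec.nat_mul.comp (Primrec.const m) Primrec.fst) Primrec.snd)
    |>.exists_code
  have htest : MLTest A fun n => Cyl (catPow D (m * n)) := by
    refine ⟨fun n => catPow D (m * n), ⟨c, fun n σ => hc (n, σ)⟩, fun _ => rfl,
      fun n => cyl_catPow_anti (by gcongr; omega), fun n => ?_⟩
    refine (hD.mu_cyl_catPow_le _).trans ?_
    rw [pow_mul]
    gcongr
  by_contra! h
  exact hX _ htest (Set.mem_iInter.2 fun n => h _)

theorem exists_seg_eq {σ : ℕ → List Bool} (hσ : ∀ k, σ k <+: σ (k + 1))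
    (hl : ∀ k, k ≤ (σ k).length) : ∃ X : ℕ → Bool, ∀ k, seg X (σ k).length = σ k := by
  have hmono {j k : ℕ} (h : j ≤ k) : σ j <+: σ k := by
    induction k, h using Nat.le_induction with
    | base => exact List.prefix_refl _
    | succ k _ ih => exact ih.trans (hσ k)
  have hget {j k i : ℕ} (h : j ≤ k) (hi : i < (σ j).length) : (σ k)[i]? = (σ j)[i]? := by
    obtain ⟨r, hr⟩ := hmono h
    rw [← hr, List.getElem?_append_left hi]
  refine ⟨fun i => (σ (i + 1))[i]?.getD false, fun k => List.ext_getElem? fun i => ?_⟩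
  rw [getElem?_seg]
  split_ifs with hi
  · have hi' : i < (σ (i + 1)).length := hl (i + 1)
    have : (σ (i + 1))[i]? = (σ k)[i]? := by
      rcases le_total (i + 1) k with h | h
      exacts [(hget h hi').symm, hget h hi]
    rw [this, List.getElem?_eq_getElem hi]
    rfl
  · rw [List.getElem?_eq_none (by omega)]

theorem exists_seg_mem_catPow (hD : [] ∉ D) {p : List Bool → Prop} (h0 : p [])
    (hp : ∀ σ, p σ → ∃ w ∈ D, p (σ ++ w)) :
    ∃ X : ℕ → Bool, ∀ k, ∃ s ≥ k, seg X s ∈ catPow D k ∧ p (seg X s) := by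
  choose w hwD hwp using hp
  let x : ℕ → {σ // p σ} := fun k => k.rec ⟨[], h0⟩ fun _ x => ⟨x.1 ++ w x.1 x.2, hwp _ _⟩
  have hx (k : ℕ) : (x (k + 1)).1 = (x k).1 ++ w (x k).1 (x k).2 := rfl
  have hl (k : ℕ) : k ≤ (x k).1.length := by
    induction k with
    | zero => simp
    | succ k ih =>
      have : 0 < (w (x k).1 (x k).2).length :=
        List.length_pos_of_ne_nil fun h => hD (h ▸ hwD _ _)
      rw [hx, List.length_append]
      omega
  have hmem (k : ℕ) : (x k).1 ∈ catPow D k := by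
    induction k with
    | zero => exact nil_mem_catPow_zero
    | succ k ih => rw [hx]; exact append_mem_catPow ih (hwD _ _)
  obtain ⟨X, hX⟩ := exists_seg_eq (fun k => (hx k).symm ▸ List.prefix_append _ _) hl
  refine ⟨X, fun k => ⟨_, hl k, ?_⟩⟩
  rw [hX]
  exact ⟨hmem k, (x k).2⟩

/-- If `A ≤_LR B`, every `Σ₁^A` class of measure less than one is contained, up to null sets, in
a `Σ₁^B` class of measure less than one. -/
theorem LRle.exists_cover {u : OracleCode} (hu : UniversalPFM u) {A B : Set ℕ} (h : LRle A B)
    (hD : PrefixFree D) (hDA : REIn (chi A) fun σ => σ ∈ D) (hmu : mu (Cyl D) < 1) :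
    ∃ W : Set (List Bool), REIn (chi B) (fun σ => σ ∈ W) ∧ mu (Cyl W) < 1 ∧
      ∀ w ∈ D, mu (Cyl {w} \ Cyl W) = 0 := by
  set C := compressed u (chi B) with hC
  have hnil : [] ∉ D := fun hn => by
    have : mu (Cyl {[]}) ≤ mu (Cyl D) := measure_mono (cyl_mono (Set.singleton_subset_iff.2 hn))
    rw [cyl_nil, measure_univ] at this
    exact absurd this (not_le.2 hmu)
  have hmeas : MeasurableSet (Cyl C)ᶜ := (measurableSet_cyl _).compl
  have h0 : mu ((Cyl C)ᶜ ∩ Cyl {[]}) ≠ 0 := by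
    rw [cyl_nil, Set.inter_univ, Ne, prob_compl_eq_zero_iff (measurableSet_cyl _)]
    refine ((mu_compressed_le hu).trans_lt ?_).ne
    exact ENNReal.inv_lt_one.2 ENNReal.one_lt_two
  obtain ⟨σ, hσ, hσD⟩ : ∃ σ, mu ((Cyl C)ᶜ ∩ Cyl {σ}) ≠ 0 ∧
      ∀ w ∈ D, mu ((Cyl C)ᶜ ∩ Cyl {σ ++ w}) = 0 := by
    by_contra! hcon
    obtain ⟨X, hX⟩ := exists_seg_mem_catPow hnil h0 hcon
    have hXC : X ∉ Cyl C := fun hXC => by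
      obtain ⟨t, ht⟩ := mem_cyl.1 hXC
      obtain ⟨s, hts, -, hs⟩ := hX t
      refine hs ?_
      have : (Cyl C)ᶜ ∩ Cyl {seg X s} = ∅ := by
        refine Set.eq_empty_of_forall_notMem fun Y ⟨hY, hY'⟩ => hY (mem_cyl.2 ⟨t, ?_⟩)
        rw [mem_cyl_singleton, length_seg] at hY'
        rwa [← take_seg_of_le Y hts, hY', take_seg_of_le X hts]
      rw [this, measure_empty]
    obtain ⟨k, hk⟩ := (h X (mlRandom_of_notMem_compressed hu hXC)).exists_notMem_catPow hD hDA hmu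
    obtain ⟨s, -, hs, -⟩ := hX k
    exact hk (mem_cyl.2 ⟨s, hs⟩)
  have hW : prepend σ ⁻¹' Cyl C = Cyl {τ | ∃ k, (σ ++ τ).take k ∈ C} := by
    ext X
    rw [Set.mem_preimage, mem_cyl, mem_cyl]
    constructor
    · rintro ⟨t, ht⟩
      refine ⟨t, t, ?_⟩
      rwa [← seg_prepend_add, take_seg_of_le _ (by omega)]
    · rintro ⟨s, k, hk⟩
      rw [← seg_prepend_add, take_seg] at hk
      exact ⟨_, hk⟩
  refine ⟨{τ | ∃ k, (σ ++ τ).take k ∈ C}, ?_, ?_, fun w hw => ?_⟩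
  · have : REIn (chi B) fun p : List Bool × ℕ => (σ ++ p.1).take p.2 ∈ C :=
      reIn_compressed.comp (Primrec.list_take.comp Primrec.snd
        (Primrec.list_append.comp (Primrec.const σ) Primrec.fst))
    exact this.ex
  · rw [mu_inter_cyl_singleton hmeas, Set.preimage_compl, hW] at hσ
    refine prob_le_one.lt_of_ne fun h1 => right_ne_zero_of_mul hσ ?_
    exact (prob_compl_eq_zero_iff (measurableSet_cyl _)).2 h1
  · have h1 : mu ((Cyl C)ᶜ ∩ Cyl {σ ++ w} ∩ Cyl {σ}) = 0 :=
      measure_mono_null Set.inter_subset_left (hσD w hw)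
    rw [mu_inter_cyl_singleton (hmeas.inter (measurableSet_cyl _)), Set.preimage_inter,
      prepend_preimage_cyl, Set.preimage_compl, hW, mul_eq_zero] at h1
    rw [Set.sdiff_eq, Set.inter_comm]
    exact h1.resolve_left (two_inv_pow_ne_zero _)

end Kucera

section BlockDiff

/-- The list of all binary strings of length `s`. -/
def strings (s : ℕ) : List (List Bool) :=
  s.rec [[]] fun _ l => l.map (List.cons true) ++ l.map (List.cons false)

theorem strings_succ (s : ℕ) :
    strings (s + 1) = (strings s).map (List.cons true) ++ (strings s).map (List.cons false) := rfl

theorem primrec_strings : Primrec strings := by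
  have h (b : Bool) : Primrec fun p : ℕ × List (List Bool) => p.2.map (List.cons b) :=
    Primrec.list_map Primrec.snd (Primrec.list_cons.comp (Primrec.const b) Primrec.snd)
  exact Primrec.nat_rec₁ _ (Primrec.list_append.comp (h true) (h false))

theorem mem_strings {s : ℕ} {σ : List Bool} : σ ∈ strings s ↔ σ.length = s := by
  induction s generalizing σ with
  | zero => simp [strings]
  | succ s ih =>
    cases σ with
    | nil => simp [strings_succ]
    | cons b σ => cases b <;> simp [strings_succ, ih]

theorem nodup_strings (s : ℕ) : (strings s).Nodup := by
  induction s with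
  | zero => simp [strings]
  | succ s ih =>
    rw [strings_succ]
    refine (ih.map List.cons_injective).append (ih.map List.cons_injective) fun σ h1 h2 => ?_
    simp only [List.mem_map] at h1 h2
    obtain ⟨_, -, rfl⟩ := h1
    simp at h2

/-- The measure of the difference of a clopen set and a `Σ₁` open set is upper semicomputable. -/
theorem REIn.mu_block_diff_lt {O : ℕ → ℕ} {W : Set (List Bool)} (hW : REIn O fun σ => σ ∈ W) :
    REIn O fun p : ℕ × ℕ × ℕ => mu (Block p.1 p.2.1 \ Cyl W) < 2⁻¹ ^ p.2.2 := by
  classical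
  obtain ⟨Q, hQ, hmono, -, hQW⟩ := REIn.exists_decidable (ι := Unit) (W := fun _ => W)
    (hW.comp Primrec.snd)
  have hS : PrimrecRel fun (i : ℕ) (q : List Bool × List ℕ × ℕ × ℕ × ℕ) =>
      q.1[Nat.pair q.2.2.2.1 i]? ≠ some false :=
    PrimrecPred.not (Primrec.eq.comp (Primrec.list_getElem?.comp (Primrec.fst.comp Primrec.snd)
      (Primrec₂.natPair.comp (Primrec.fst.comp (Primrec.snd.comp (Primrec.snd.comp
        (Primrec.snd.comp Primrec.snd)))) Primrec.fst)) (Primrec.const _))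
  have hT : PrimrecRel fun (σ : List Bool) (q : List ℕ × ℕ × ℕ × ℕ) =>
      (∀ i < q.2.1, σ[Nat.pair q.2.2.1 i]? ≠ some false) ∧ ¬ Q q.1 ((), σ) :=
    (primrecPred_forall_lt hS (Primrec.fst.comp (Primrec.snd.comp Primrec.snd))).and
      (PrimrecPred.not (hQ.comp (Primrec.fst.comp Primrec.snd)
        (Primrec.pair (Primrec.const ()) Primrec.fst)))
  set l : List ℕ × ℕ × ℕ × ℕ → List (List Bool) := fun q => (strings q.1.length).filter fun σ =>
    (∀ i < q.2.1, σ[Nat.pair q.2.2.1 i]? ≠ some false) ∧ ¬ Q q.1 ((), σ) with hl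
  have hlp : Primrec l := by
    refine (hT.listFilter.comp (primrec_strings.comp (Primrec.list_length.comp Primrec.fst))
      Primrec.id).of_eq fun q => ?_
    rfl
  refine ⟨fun L p => (l (L, p)).length * 2 ^ p.2.2 < 2 ^ L.length, ?_, fun ⟨n, j, k⟩ => ?_⟩
  · have hk : Primrec fun q : List ℕ × ℕ × ℕ × ℕ => q.2.2.2 :=
      Primrec.snd.comp (Primrec.snd.comp Primrec.snd)
    exact Primrec.nat_lt.comp (Primrec.nat_mul.comp (Primrec.list_length.comp hlp)
      (primrec_pow.comp (Primrec.const 2) hk))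
      (primrec_pow.comp (Primrec.const 2) (Primrec.list_length.comp Primrec.fst))
  set E : ℕ → Set (ℕ → Bool) := fun s => {X | seg X s ∈ l (seg O s, n, j, k)} with hE
  have hmem (X : ℕ → Bool) (s : ℕ) : X ∈ E s ↔
      (∀ i < n, Nat.pair j i < s → X (Nat.pair j i) = true) ∧ ¬ Q (seg O s) ((), seg X s) := by
    simp only [hE, hl, Set.mem_ofPred_eq, List.mem_filter, mem_strings, length_seg, true_and,
      decide_eq_true_eq, getElem?_seg]
    refine and_congr_left fun _ => forall₂_congr fun i _ => ?_
    split_ifs with h <;> simp [h]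
  have hmu (s : ℕ) : mu (E s) = (l (seg O s, n, j, k)).length * 2⁻¹ ^ s :=
    mu_seg_mem ((nodup_strings _).filter _) fun σ hσ => by
      simpa using mem_strings.1 (List.mem_filter.1 hσ).1
  have hanti : Antitone E := by
    intro s t hst X hX
    rw [hmem] at hX ⊢
    refine ⟨fun i hi his => hX.1 i hi (his.trans_le hst), fun h => hX.2 ?_⟩
    have := hmono () (seg X s) (seg X t) (seg_prefix_seg hst)
    rw [length_seg, length_seg] at this
    exact this h
  have hinter : Block n j \ Cyl W = ⋂ s, E s := by
    ext X
    simp only [Set.mem_sdiff, Set.mem_iInter, hmem, hQW (), Block, Set.mem_ofPred_eq, not_exists]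
    constructor
    · exact fun h s => ⟨fun i hi _ => h.1 i hi, h.2 s⟩
    · exact fun h => ⟨fun i hi => (h (Nat.pair j i + 1)).1 i hi (Nat.lt_succ_self _),
        fun s => (h s).2⟩
  have hmeas (s : ℕ) : MeasurableSet (E s) := by
    have : E s = ⋃ σ ∈ {σ | σ ∈ l (seg O s, n, j, k)}, {X | seg X s = σ} := by ext X; simp [hE]
    rw [this]
    exact MeasurableSet.biUnion (Set.to_countable _) fun σ _ => measurableSet_seg_eq σ s
  dsimp only
  rw [hinter, hanti.measure_iInter (fun s => (hmeas s).nullMeasurableSet)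
    ⟨0, measure_ne_top _ _⟩, iInf_lt_iff]
  refine exists_congr fun s => ?_
  rw [hmu, length_seg, ← ENNReal.inv_pow, ← ENNReal.inv_pow, ← div_eq_mul_inv,
    ENNReal.div_lt_iff (by simp) (by simp), mul_comm ((2 : ℝ≥0∞) ^ k)⁻¹,
    ← div_eq_mul_inv, ENNReal.lt_div_iff_mul_lt (by simp) (by simp)]
  exact_mod_cast Iff.rfl

end BlockDiff

section Product

theorem prod_one_sub_mul_one_add_sum_le {ι : Type*} (F : Finset ι) {x : ι → ℝ≥0∞}
    (hx : ∀ i ∈ F, x i ≤ 1) : (∏ i ∈ F, (1 - x i)) * (1 + ∑ i ∈ F, x i) ≤ 1 := by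
  classical
  induction F using Finset.induction_on with
  | empty => simp
  | insert a F ha ih =>
    have ih := ih fun i hi => hx i (Finset.mem_insert_of_mem hi)
    have hy : (1 - x a) + x a = 1 := tsub_add_cancel_of_le (hx a (Finset.mem_insert_self _ _))
    rw [Finset.prod_insert ha, Finset.sum_insert ha]
    refine le_trans ?_ ih
    generalize 1 - x a = y at hy
    have hy1 : y ≤ 1 := hy ▸ le_self_add
    calc y * (∏ i ∈ F, (1 - x i)) * (1 + (x a + ∑ i ∈ F, x i))
        = (∏ i ∈ F, (1 - x i)) * (y + (y * x a + y * ∑ i ∈ F, x i)) := by ring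
      _ ≤ (∏ i ∈ F, (1 - x i)) * (y + (1 * x a + 1 * ∑ i ∈ F, x i)) := by gcongr
      _ = (∏ i ∈ F, (1 - x i)) * (1 + ∑ i ∈ F, x i) := by
        rw [one_mul, one_mul, ← add_assoc, hy]

end Product

section Main

/-- The sets `Block (n + 1) j`, with `j` coding the pair `(n, τ)`. -/
def codeBlock (q : ℕ × List Bool) : Set (ℕ → Bool) := Block (q.1 + 1) (Encodable.encode q)

theorem mu_biInter_compl_codeBlock (F : Finset (ℕ × List Bool)) :
    mu (⋂ q ∈ F, (codeBlock q)ᶜ) = ∏ q ∈ F, (1 - 2⁻¹ ^ (q.1 + 1)) := by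
  have h := mu_biInter_compl_block
    (fun j => ((Encodable.decode (α := ℕ × List Bool) j).getD default).1 + 1)
    (F.image Encodable.encode)
  rw [Finset.prod_image fun _ _ _ _ h => Encodable.encode_injective h,
    Finset.set_biInter_finset_image] at h
  simpa only [Encodable.encodek, Option.getD_some, codeBlock] using h

theorem LRle.exists_cover_codeBlock {u : OracleCode} (hu : UniversalPFM u) {A B : Set ℕ}
    (h : LRle A B) : ∃ W : Set (List Bool), REIn (chi B) (fun σ => σ ∈ W) ∧ mu (Cyl W) < 1 ∧
      ∀ ρ τ, τ ∈ evalStr u (chi A) ρ → mu (codeBlock (ρ.length, τ) \ Cyl W) = 0 := by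
  set S : Set (List Bool) := {σ | ∃ q : List Bool × List Bool, q.2 ∈ evalStr u (chi A) q.1 ∧
    ∀ i < q.1.length + 1, σ[Nat.pair (Encodable.encode (q.1.length, q.2)) i]? = some true}
  have hS : REIn (chi A) fun p : Unit × List Bool => p.2 ∈ S := by
    have hi : PrimrecRel fun (i : ℕ) (p : (Unit × List Bool) × List Bool × List Bool) =>
        p.1.2[Nat.pair (Encodable.encode (p.2.1.length, p.2.2)) i]? = some true :=
      Primrec.eq.comp (Primrec.list_getElem?.comp
        (Primrec.snd.comp (Primrec.fst.comp Primrec.snd)) (Primrec₂.natPair.comp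
        (Primrec.encode.comp (Primrec.pair (Primrec.list_length.comp
          (Primrec.fst.comp (Primrec.snd.comp Primrec.snd)))
          (Primrec.snd.comp (Primrec.snd.comp Primrec.snd)))) Primrec.fst)) (Primrec.const _)
    have h2 := primrecPred_forall_lt hi (f := fun p => p.2.1.length + 1)
      (Primrec.succ.comp (Primrec.list_length.comp (Primrec.fst.comp Primrec.snd)))
    exact (((REIn.evalStr u).comp Primrec.snd).and (REIn.of_primrecPred h2)).ex
  have hcyl : Cyl S = {X | ∃ ρ τ, τ ∈ evalStr u (chi A) ρ ∧ X ∈ codeBlock (ρ.length, τ)} := by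
    ext X
    rw [mem_cyl]
    constructor
    · rintro ⟨s, ⟨ρ, τ⟩, hτ, hX⟩
      refine ⟨ρ, τ, hτ, fun i hi => ?_⟩
      have := hX i hi
      rw [getElem?_seg] at this
      split_ifs at this
      exact Option.some_injective _ this
    · rintro ⟨ρ, τ, hτ, hX⟩
      refine ⟨Nat.pair (Encodable.encode (ρ.length, τ)) (ρ.length + 1), (ρ, τ), hτ, fun i hi => ?_⟩
      rw [getElem?_seg, if_pos (Nat.pair_lt_pair_right _ hi), hX i hi]
  obtain ⟨D, hD, hpf, hDS⟩ := REIn.exists_prefixFree (ι := Unit) (W := fun _ => S) hS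
  have hmu : mu (Cyl (D ())) < 1 := by
    rw [hDS, hcyl]
    refine (mu_exists_eval_le hu _ fun ρ τ _ => ?_).trans_lt
      (ENNReal.inv_lt_one.2 ENNReal.one_lt_two)
    rw [codeBlock, mu_block]
  obtain ⟨W, hW, hW1, hWD⟩ := h.exists_cover hu (hpf ())
    (hD.comp (Primrec.pair (Primrec.const ()) Primrec.id)) hmu
  refine ⟨W, hW, hW1, fun ρ τ hτ => ?_⟩
  have hsub : codeBlock (ρ.length, τ) \ Cyl W ⊆ ⋃ w ∈ D (), (Cyl {w} \ Cyl W) := by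
    rintro X ⟨hX, hXW⟩
    have : X ∈ Cyl (D ()) := by
      rw [hDS, hcyl]
      exact ⟨ρ, τ, hτ, hX⟩
    rw [cyl_eq_biUnion] at this
    obtain ⟨w, hw, hXw⟩ := Set.mem_iUnion₂.1 this
    exact Set.mem_biUnion hw ⟨hXw, hXW⟩
  exact measure_mono_null hsub ((measure_biUnion_null_iff (Set.to_countable _)).2 hWD)

theorem sum_two_inv_pow_encode_le {α : Type*} [Encodable α] (F : Finset α) :
    ∑ a ∈ F, (2⁻¹ : ℝ≥0∞) ^ Encodable.encode a ≤ 2 := by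
  calc ∑ a ∈ F, (2⁻¹ : ℝ≥0∞) ^ Encodable.encode a
      = ∑ n ∈ F.map ⟨Encodable.encode, Encodable.encode_injective⟩, 2⁻¹ ^ n := by simp
    _ ≤ ∑' n : ℕ, 2⁻¹ ^ n := ENNReal.sum_le_tsum _
    _ = 2 := by rw [ENNReal.tsum_geometric, ENNReal.one_sub_inv_two, inv_inv]

theorem exists_two_inv_pow_lt {ε : ℝ≥0∞} (hε : ε ≠ 0) : ∃ c : ℕ, 2⁻¹ ^ c < ε :=
  ((ENNReal.tendsto_pow_atTop_nhds_zero_of_lt_one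
    (ENNReal.inv_lt_one.2 ENNReal.one_lt_two)).eventually
      (gt_mem_nhds (pos_iff_ne_zero.2 hε))).exists

/-- If an open set of measure less than one nearly contains many independent blocks, then the sum
of the measures of these blocks is finite. -/
theorem exists_tsum_codeBlock_le {V : Set (ℕ → Bool)} (hV : MeasurableSet V) (hV1 : mu V < 1) :
    ∃ c m : ℕ, ∑' q : {q : ℕ × List Bool // mu (codeBlock q \ V) < 2⁻¹ ^ (Encodable.encode q + c)},
      (2⁻¹ : ℝ≥0∞) ^ (q.1.1 + 1 + m) ≤ 1 := by
  have hδ : mu Vᶜ ≠ 0 := fun h => hV1.ne ((prob_compl_eq_zero_iff hV).1 h)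
  have hδ2 : mu Vᶜ / 2 ≠ 0 := by simpa using hδ
  have hδt : mu Vᶜ / 2 ≠ ∞ := (ENNReal.half_le_self.trans_lt (measure_lt_top _ _)).ne
  obtain ⟨c, hc⟩ := exists_two_inv_pow_lt (ε := mu Vᶜ / 2 / 2) (by simpa using hδ)
  obtain ⟨m, hm⟩ := exists_two_inv_pow_lt hδ2
  refine ⟨c, m, ?_⟩
  rw [ENNReal.tsum_eq_iSup_sum]
  refine iSup_le fun F' => ?_
  set F : Finset (ℕ × List Bool) := F'.map (Function.Embedding.subtype _)
  have hF : ∀ q ∈ F, mu (codeBlock q \ V) < 2⁻¹ ^ (Encodable.encode q + c) := by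
    intro q hq
    obtain ⟨q, -, rfl⟩ := Finset.mem_map.1 hq
    exact q.2
  have hsum : ∑ q ∈ F', (2⁻¹ : ℝ≥0∞) ^ (q.1.1 + 1 + m) = (∑ q ∈ F, 2⁻¹ ^ (q.1 + 1)) * 2⁻¹ ^ m := by
    simp_rw [pow_add _ _ m, ← Finset.sum_mul]
    rw [Finset.sum_map]
    rfl
  have hle : mu Vᶜ ≤ ∏ q ∈ F, (1 - 2⁻¹ ^ (q.1 + 1)) + mu Vᶜ / 2 := by
    calc mu Vᶜ ≤ mu ((⋂ q ∈ F, (codeBlock q)ᶜ) ∪ ⋃ q ∈ F, (codeBlock q \ V)) := by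
          refine measure_mono fun X hX => ?_
          by_cases h : ∃ q ∈ F, X ∈ codeBlock q
          · obtain ⟨q, hq, hXq⟩ := h
            exact Or.inr (Set.mem_biUnion hq ⟨hXq, hX⟩)
          · push Not at h
            exact Or.inl (Set.mem_iInter₂.2 h)
      _ ≤ mu (⋂ q ∈ F, (codeBlock q)ᶜ) + ∑ q ∈ F, mu (codeBlock q \ V) :=
          (measure_union_le _ _).trans (add_le_add_right (measure_biUnion_finset_le _ _) _)
      _ ≤ ∏ q ∈ F, (1 - 2⁻¹ ^ (q.1 + 1)) + 2 * (mu Vᶜ / 2 / 2) := by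
          rw [mu_biInter_compl_codeBlock]
          gcongr
          calc ∑ q ∈ F, mu (codeBlock q \ V)
              ≤ ∑ q ∈ F, 2⁻¹ ^ Encodable.encode q * 2⁻¹ ^ c :=
                Finset.sum_le_sum fun q hq => (hF q hq).le.trans_eq (pow_add _ _ _)
            _ ≤ 2 * (mu Vᶜ / 2 / 2) := by
                rw [← Finset.sum_mul]
                exact mul_le_mul' (sum_two_inv_pow_encode_le F) hc.le
      _ = _ := by rw [ENNReal.mul_div_cancel (by simp) (by simp)]
  have hprod : mu Vᶜ / 2 ≤ ∏ q ∈ F, (1 - 2⁻¹ ^ (q.1 + 1)) := by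
    refine (ENNReal.add_le_add_iff_right hδt).1 ?_
    rwa [ENNReal.add_halves]
  rw [hsum, mul_comm]
  calc 2⁻¹ ^ m * ∑ q ∈ F, (2⁻¹ : ℝ≥0∞) ^ (q.1 + 1)
      ≤ (∏ q ∈ F, (1 - 2⁻¹ ^ (q.1 + 1))) * (1 + ∑ q ∈ F, 2⁻¹ ^ (q.1 + 1)) :=
        mul_le_mul' (hm.le.trans hprod) le_add_self
    _ ≤ 1 := prod_one_sub_mul_one_add_sum_le F fun q _ => pow_le_one₀ (by simp) (by simp)

theorem LKle.of_forall_evalStr {u : OracleCode} {A B : Set ℕ} (d : ℕ)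
    (h : ∀ ρ τ, τ ∈ evalStr u (chi A) ρ → ∃ σ, τ ∈ evalStr u (chi B) σ ∧
      σ.length ≤ ρ.length + d) : LKle u A B := by
  refine ⟨d, fun τ => ?_⟩
  rw [K, K, ENat.iInf₂_add]
  refine le_iInf₂ fun ρ hρ => ?_
  obtain ⟨σ, hσ, hl⟩ := h ρ τ hρ
  exact (iInf₂_le σ hσ).trans (by exact_mod_cast hl)

end Main

/-- If `A ≤_LR B` then `A ≤_LK B` (for any universal prefix-free oracle machine). -/
theorem lr_implies_lk (u : OracleCode) (hu : UniversalPFM u) (A B : Set ℕ)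
    (h : LRle A B) : LKle u A B := by
  obtain ⟨W, hW, hW1, hWA⟩ := h.exists_cover_codeBlock hu
  obtain ⟨c, m, hcm⟩ := exists_tsum_codeBlock_le (measurableSet_cyl W) hW1
  have hf : Primrec fun q : ℕ × List Bool =>
      (q.1 + 1, Encodable.encode q, Encodable.encode q + c) :=
    Primrec.pair (Primrec.succ.comp Primrec.fst) (Primrec.pair Primrec.encode
      (Primrec.nat_add.comp Primrec.encode (Primrec.const c)))
  have hlen : Primrec fun q : ℕ × List Bool => q.1 + 1 + m :=
    Primrec.nat_add.comp (Primrec.succ.comp Primrec.fst) (Primrec.const m)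
  have hR : REIn (chi B) fun q => mu (codeBlock q \ Cyl W) < 2⁻¹ ^ (Encodable.encode q + c) :=
    hW.mu_block_diff_lt.comp hf
  obtain ⟨d, hd⟩ := hR.kraft_chaitin hu
    (len := fun q => q.1 + 1 + m) (out := fun q => q.2) hlen Primrec.snd hcm
  refine LKle.of_forall_evalStr (1 + m + d) fun ρ τ hτ => ?_
  obtain ⟨σ, hσ, hl⟩ := hd (ρ.length, τ) <| by
    rw [hWA ρ τ hτ]
    exact pos_iff_ne_zero.2 (two_inv_pow_ne_zero _)
  exact ⟨σ, hσ, by dsimp only at hl; omega⟩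

end LMD
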